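/- Let b be a fixed positive integer. Then for every n ≥ 1, lim_{N→∞} E[ tr( ( U_{bN}^{Γ_{b,N}} ( U_{bN}^{Γ_{b,N}} )^* )^n ) ] = Σ_π Π_{B ∈ π} b^{2−|B|} (−1)^{|B|/2 − 1} C_{|B|/2 − 1}, where the sum runs over all non-crossing partitions π of [2n] all of whose blocks have even cardinality, the product runs over the blocks B of π, and C_k = (1/(k+1))·binom(2k,k) is the k-th Catalan number. (Equivalently, b·U_{bN}^{Γ_{b,N}} has the limiting *-distribution of a sum of b² free Haar unitaries: its alternating *-moments are those of an R-diagonal element with alternating free cumulants of order 2r equal to b^{2−2r}(−1)^{r−1}C_{r−1}.) -/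

import Mathlib

open MeasureTheory Matrix Filter

noncomputable instance matMS (N : ℕ) : MeasurableSpace (Matrix (Fin N) (Fin N) ℂ) :=
  (inferInstance : MeasurableSpace (Fin N → Fin N → ℂ))

/-- The matrix with entries permuted by `σ`: `(U^σ)_{i,j} = U_{σ(i,j)}`. -/
def permMat {N : ℕ} (σ : Equiv.Perm (Fin N × Fin N)) (U : Matrix (Fin N) (Fin N) ℂ) :
    Matrix (Fin N) (Fin N) ℂ :=
  Matrix.of fun i j => U (σ (i, j)).1 (σ (i, j)).2

/-- `μ` is the law of an `N × N` Haar-distributed random unitary matrix. -/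
def IsHaarUnitary (N : ℕ) (μ : Measure (Matrix (Fin N) (Fin N) ℂ)) : Prop :=
  IsProbabilityMeasure μ ∧
  (∀ᵐ U ∂μ, U ∈ Matrix.unitaryGroup (Fin N) ℂ) ∧
  ∀ V ∈ Matrix.unitaryGroup (Fin N) ℂ, μ.map (fun U => V * U) = μ

/-- Transposition of the inner (block) indices: `((α1,β1),(α2,β2)) ↦ ((α1,β2),(α2,β1))`. -/
def blockSwap (b d : ℕ) : Equiv.Perm ((Fin b × Fin d) × (Fin b × Fin d)) where
  toFun x := ((x.1.1, x.2.2), (x.2.1, x.1.2))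
  invFun x := ((x.1.1, x.2.2), (x.2.1, x.1.2))
  left_inv _ := rfl
  right_inv _ := rfl

/-- The `(b,d)`-partial transpose `Γ_{b,d}`, via the identification
`Fin b × Fin d ≃ Fin (b*d)`, `(α,β) ↦ α·d + β` (the `0`-based version of `(α-1)d + β`). -/
def ptrans (b d : ℕ) : Equiv.Perm (Fin (b * d) × Fin (b * d)) :=
  ((Equiv.prodCongr finProdFinEquiv.symm finProdFinEquiv.symm).trans (blockSwap b d)).trans
    (Equiv.prodCongr finProdFinEquiv finProdFinEquiv)

/-- A partition of `[2n]` is non-crossing with all blocks of even cardinality. -/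
def NCEven (n : ℕ) (π : Finpartition (Finset.univ : Finset (Fin (2 * n)))) : Prop :=
  (∀ P ∈ π.parts, Even P.card) ∧
  ¬ ∃ P ∈ π.parts, ∃ Q ∈ π.parts, P ≠ Q ∧ ∃ a b c d : Fin (2 * n),
      a < b ∧ b < c ∧ c < d ∧ a ∈ P ∧ c ∈ P ∧ b ∈ Q ∧ d ∈ Q

namespace NCPart

variable {α : Type*} [LinearOrder α]

/-- `p` is the set of blocks of a non-crossing partition of `s`. -/
structure IsNC (s : Finset α) (p : Finset (Finset α)) : Prop where
  ne : ∀ P ∈ p, P.Nonempty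
  sub : ∀ P ∈ p, P ⊆ s
  cover : ∀ x ∈ s, ∃ P ∈ p, x ∈ P
  disj : ∀ P ∈ p, ∀ Q ∈ p, ∀ x, x ∈ P → x ∈ Q → P = Q
  nc : ∀ P ∈ p, ∀ Q ∈ p, ∀ a b c d, a < b → b < c → c < d → a ∈ P → c ∈ P → b ∈ Q → d ∈ Q → P = Q

open Classical in
/-- The finite set of all non-crossing partitions of `s`. -/
noncomputable def ncp (s : Finset α) : Finset (Finset (Finset α)) :=
  s.powerset.powerset.filter (IsNC s)

theorem mem_ncp {s : Finset α} {p : Finset (Finset α)} : p ∈ ncp s ↔ IsNC s p := by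
  classical
  simp only [ncp, Finset.mem_filter, Finset.mem_powerset, and_iff_right_iff_imp]
  intro h P hP
  exact Finset.mem_powerset.2 (h.sub P hP)

/-- The weight of a partition, in which the size of the block of `e` is increased by `k`. -/
def wt (κ : ℕ → ℂ) (k : ℕ) (e : α) (p : Finset (Finset α)) : ℂ :=
  ∏ P ∈ p, κ (P.card + if e ∈ P then k else 0)

/-- The total weight of the non-crossing partitions of `s`. -/
noncomputable def total (κ : ℕ → ℂ) (k : ℕ) (e : α) (s : Finset α) : ℂ :=
  ∑ p ∈ ncp s, wt κ k e p

theorem total_zero (κ : ℕ → ℂ) (e e' : α) (s : Finset α) : total κ 0 e s = total κ 0 e' s := by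
  simp [total, wt]

theorem ncp_empty : ncp (∅ : Finset α) = {∅} := by
  ext p
  rw [mem_ncp, Finset.mem_singleton]
  constructor
  · intro h
    refine Finset.eq_empty_of_forall_notMem fun P hP => ?_
    have := h.ne P hP
    have h2 := h.sub P hP
    simp_all
  · rintro rfl
    constructor <;> simp

theorem total_empty (κ : ℕ → ℂ) (k : ℕ) (e : α) : total κ k e (∅ : Finset α) = 1 := by
  simp [total, ncp_empty, wt]

/-- The partitions in which the minimum `a` is a singleton. -/
theorem sum_singleton (κ : ℕ → ℂ) (k : ℕ) (a : α) (s : Finset α) (ha : ∀ x ∈ s, a < x) :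
    ∑ p ∈ (ncp (insert a s)).filter (fun p => {a} ∈ p), wt κ k a p
      = κ (1 + k) * total κ 0 a s := by
  classical
  have has : a ∉ s := fun h => lt_irrefl _ (ha a h)
  rw [total, Finset.mul_sum]
  have hA : ∀ p, IsNC s p → ∀ P ∈ p, a ∉ P := fun p hp P hP h => has (hp.sub P hP h)
  refine Finset.sum_bij' (fun p _ => p.erase {a}) (fun p _ => insert {a} p) ?_ ?_ ?_ ?_ ?_
  · intro p hp
    simp only [Finset.mem_filter, mem_ncp] at hp ⊢
    obtain ⟨h, h1⟩ := hp
    refine ⟨fun P hP => h.ne P (Finset.mem_of_mem_erase hP), ?_, ?_, ?_, ?_⟩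
    · intro P hP x hx
      have h2 := h.sub P (Finset.mem_of_mem_erase hP) hx
      have h3 := Finset.ne_of_mem_erase hP
      have := h.disj P (Finset.mem_of_mem_erase hP) {a} h1 x hx
      grind
    · intro x hx
      obtain ⟨P, hP, hxP⟩ := h.cover x (Finset.mem_insert_of_mem hx)
      exact ⟨P, by grind, hxP⟩
    · intro P hP Q hQ
      exact h.disj P (Finset.mem_of_mem_erase hP) Q (Finset.mem_of_mem_erase hQ)
    · intro P hP Q hQ
      exact h.nc P (Finset.mem_of_mem_erase hP) Q (Finset.mem_of_mem_erase hQ)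
  · intro p hp
    simp only [Finset.mem_filter, mem_ncp] at hp ⊢
    have hA := hA p hp
    refine ⟨⟨?_, ?_, ?_, ?_, ?_⟩, by simp⟩
    · have := hp.ne
      intro P hP
      rcases Finset.mem_insert.1 hP with rfl | hP
      · simp
      · exact hp.ne P hP
    · have := hp.sub
      grind
    · have := hp.cover
      grind
    · have := hp.disj
      grind
    · intro P hP Q hQ a' b c d h1 h2 h3 h4 h5 h6 h7
      rcases Finset.mem_insert.1 hP with rfl | hP <;> rcases Finset.mem_insert.1 hQ with rfl | hQ
      · rfl
      · simp only [Finset.mem_singleton] at h4 h5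
        subst h4; subst h5; exact absurd (h1.trans h2) (lt_irrefl _)
      · simp only [Finset.mem_singleton] at h6 h7
        subst h6; subst h7; exact absurd (h2.trans h3) (lt_irrefl _)
      · exact hp.nc P hP Q hQ a' b c d h1 h2 h3 h4 h5 h6 h7
  · intro p hp
    simp only [Finset.mem_filter] at hp
    exact Finset.insert_erase hp.2
  · intro p hp
    have := hA p (mem_ncp.1 hp)
    exact Finset.erase_insert (fun h => this _ h (Finset.mem_singleton_self a))
  · intro p hp
    simp only [Finset.mem_filter, mem_ncp] at hp
    obtain ⟨h, h1⟩ := hp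
    rw [wt, wt, ← Finset.mul_prod_erase _ _ h1]
    congr 1
    · simp
    · refine Finset.prod_congr rfl fun P hP => ?_
      have h3 := h.disj P (Finset.mem_of_mem_erase hP) {a} h1 a
      have : a ∉ P := by grind
      simp [this]

/-- The element `q` follows `a` in the block of `a`. -/
def Nxt (a q : α) (p : Finset (Finset α)) : Prop :=
  ∃ P ∈ p, a ∈ P ∧ q ∈ P ∧ q ≠ a ∧ ∀ x ∈ P, x = a ∨ q ≤ x

theorem block_cases {a q : α} {s : Finset α} (ha : ∀ x ∈ s, a < x) {p : Finset (Finset α)}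
    (hp : IsNC (insert a s) p) {P₀ : Finset α} (h0 : P₀ ∈ p) (ha0 : a ∈ P₀) (hq0 : q ∈ P₀)
    (hqa : q ≠ a) {P : Finset α} (hP : P ∈ p) (hne : P ≠ P₀) :
    P ⊆ s.filter (· < q) ∨ P ⊆ s.filter (q ≤ ·) := by
  by_contra! hcon
  obtain ⟨h1, h2⟩ := hcon
  obtain ⟨y, hy, hy'⟩ := Finset.not_subset.1 h1
  obtain ⟨x, hx, hx'⟩ := Finset.not_subset.1 h2
  have haP : ∀ z ∈ P, z ∈ s := by
    intro z hz
    rcases Finset.mem_insert.1 (hp.sub P hP hz) with rfl | h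
    · exact absurd (hp.disj P hP P₀ h0 z hz ha0) hne
    · exact h
  have hy2 : q ≤ y := by
    by_contra hlt
    exact hy' (Finset.mem_filter.2 ⟨haP y hy, not_le.1 hlt⟩)
  have hx2 : x < q := by
    by_contra hlt
    exact hx' (Finset.mem_filter.2 ⟨haP x hx, not_lt.1 hlt⟩)
  have hyq : q ≠ y := by
    rintro rfl
    exact hne (hp.disj P hP P₀ h0 q hy hq0)
  exact hne (hp.nc P₀ h0 P hP a x q y (ha x (haP x hx)) hx2 (lt_of_le_of_ne hy2 hyq)
    ha0 hq0 hx hy).symm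

/-- Insert `a` into `Q` if `q ∈ Q`. -/
def ins (a q : α) (Q : Finset α) : Finset α := if q ∈ Q then insert a Q else Q

theorem erase_ins {a q : α} {Q : Finset α} (h : a ∉ Q) : (ins a q Q).erase a = Q := by
  unfold ins
  split_ifs <;> simp [h]

theorem isNC_glue {a q : α} {s : Finset α} (ha : ∀ x ∈ s, a < x) (hq : q ∈ s)
    {p₁ p₂ : Finset (Finset α)} (h₁ : IsNC (s.filter (· < q)) p₁)
    (h₂ : IsNC (s.filter (q ≤ ·)) p₂) : IsNC (insert a s) (p₁ ∪ p₂.image (ins a q)) := by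
  have hm1 : ∀ P ∈ p₁, ∀ x ∈ P, x ∈ s ∧ x < q := fun P hP x hx =>
    Finset.mem_filter.1 (h₁.sub P hP hx)
  have hm2 : ∀ P ∈ p₂, ∀ x ∈ P, x ∈ s ∧ q ≤ x := fun P hP x hx =>
    Finset.mem_filter.1 (h₂.sub P hP hx)
  have hi : ∀ Q x, x ∈ ins a q Q ↔ x ∈ Q ∨ (x = a ∧ q ∈ Q) := by
    intro Q x
    unfold ins
    split_ifs with h <;> simp [h, or_comm]
  have haq := ha q hq
  have key : ∀ P ∈ p₁ ∪ p₂.image (ins a q), P ∈ p₁ ∨ ∃ Q ∈ p₂, P = ins a q Q := by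
    intro P hP
    rcases Finset.mem_union.1 hP with h | h
    · exact Or.inl h
    · obtain ⟨Q, hQ, rfl⟩ := Finset.mem_image.1 h
      exact Or.inr ⟨Q, hQ, rfl⟩
  refine ⟨?_, ?_, ?_, ?_, ?_⟩
  · intro P hP
    rcases key P hP with h | ⟨Q, hQ, rfl⟩
    · exact h₁.ne P h
    · obtain ⟨x, hx⟩ := h₂.ne Q hQ
      exact ⟨x, (hi Q x).2 (Or.inl hx)⟩
  · intro P hP x hx
    rcases key P hP with h | ⟨Q, hQ, rfl⟩
    · exact Finset.mem_insert_of_mem (hm1 P h x hx).1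
    · rcases (hi Q x).1 hx with h | ⟨rfl, -⟩
      · exact Finset.mem_insert_of_mem (hm2 Q hQ x h).1
      · exact Finset.mem_insert_self _ _
  · intro x hx
    rcases Finset.mem_insert.1 hx with rfl | hx
    · obtain ⟨Q, hQ, hqQ⟩ := h₂.cover q (by simp [hq])
      exact ⟨ins x q Q, Finset.mem_union_right _ (Finset.mem_image_of_mem _ hQ),
        (hi Q x).2 (Or.inr ⟨rfl, hqQ⟩)⟩
    · by_cases hxq : x < q
      · obtain ⟨Q, hQ, hqQ⟩ := h₁.cover x (by simp [hx, hxq])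
        exact ⟨Q, Finset.mem_union_left _ hQ, hqQ⟩
      · obtain ⟨Q, hQ, hqQ⟩ := h₂.cover x (by simp [hx, not_lt.1 hxq])
        exact ⟨ins a q Q, Finset.mem_union_right _ (Finset.mem_image_of_mem _ hQ),
          (hi Q x).2 (Or.inl hqQ)⟩
  · intro P hP P' hP' x hx hx'
    rcases key P hP with h | ⟨Q, hQ, rfl⟩ <;> rcases key P' hP' with h' | ⟨Q', hQ', rfl⟩
    · exact h₁.disj P h P' h' x hx hx'
    · have := hm1 P h x hx
      rcases (hi _ _).1 hx' with h3 | ⟨rfl, -⟩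
      · exact absurd (hm2 _ hQ' x h3).2 (not_le.2 this.2)
      · exact absurd (ha _ this.1) (lt_irrefl _)
    · have := hm1 P' h' x hx'
      rcases (hi _ _).1 hx with h3 | ⟨rfl, -⟩
      · exact absurd (hm2 _ hQ x h3).2 (not_le.2 this.2)
      · exact absurd (ha _ this.1) (lt_irrefl _)
    · congr 1
      rcases (hi _ _).1 hx with h3 | ⟨rfl, h3⟩ <;> rcases (hi _ _).1 hx' with h4 | ⟨h5, h4⟩
      · exact h₂.disj Q hQ Q' hQ' x h3 h4
      · subst h5; exact absurd (ha _ (hm2 Q hQ x h3).1) (lt_irrefl _)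
      · exact absurd (ha _ (hm2 Q' hQ' x h4).1) (lt_irrefl _)
      · exact h₂.disj Q hQ Q' hQ' q h3 h4
  · intro P hP P' hP' x y z w hxy hyz hzw hx hz hy hw
    have hlo : ∀ Q ∈ p₂, ∀ u ∈ ins a q Q, u ∈ Q ∧ q ≤ u ∨ u = a ∧ q ∈ Q := by
      intro Q hQ u hu
      rcases (hi Q u).1 hu with h | h
      · exact Or.inl ⟨h, (hm2 Q hQ u h).2⟩
      · exact Or.inr h
    have hge : ∀ Q ∈ p₂, ∀ u ∈ ins a q Q, a ≤ u := by
      intro Q hQ u hu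
      rcases (hi Q u).1 hu with h | h
      · exact (ha _ (hm2 Q hQ u h).1).le
      · exact h.1.ge
    rcases key P hP with h | ⟨Q, hQ, rfl⟩ <;> rcases key P' hP' with h' | ⟨Q', hQ', rfl⟩
    · exact h₁.nc P h P' h' x y z w hxy hyz hzw hx hz hy hw
    · have h1 := hm1 P h x hx
      have h2 := hm1 P h z hz
      have hax := ha x h1.1
      rcases hlo Q' hQ' y hy with h3 | h3
      · exact absurd (hyz.trans h2.2) (not_lt.2 h3.2)
      · rw [h3.1] at hxy
        exact absurd (hxy.trans hax) (lt_irrefl _)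
    · have h1 := hm1 P' h' y hy
      have h2 := hm1 P' h' w hw
      have hax := ha y h1.1
      rcases hlo Q hQ z hz with h3 | h3
      · exact absurd (hzw.trans h2.2) (not_lt.2 h3.2)
      · rw [h3.1] at hyz
        exact absurd (hyz.trans hax) (lt_irrefl _)
    · have hax := hge Q hQ x hx
      have hy3 : y ∈ Q' ∧ q ≤ y := by
        rcases hlo Q' hQ' y hy with h3 | h3
        · exact h3
        · exact absurd (hax.trans_lt hxy) (by rw [h3.1]; exact lt_irrefl _)
      have hz3 : z ∈ Q ∧ q ≤ z := by
        rcases hlo Q hQ z hz with h3 | h3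
        · exact h3
        · exact absurd (hax.trans_lt (hxy.trans hyz)) (by rw [h3.1]; exact lt_irrefl _)
      have hw3 : w ∈ Q' ∧ q ≤ w := by
        rcases hlo Q' hQ' w hw with h3 | h3
        · exact h3
        · exact absurd (hax.trans_lt (hxy.trans (hyz.trans hzw))) (by rw [h3.1]; exact lt_irrefl _)
      congr 1
      rcases hlo Q hQ x hx with h3 | h3
      · exact h₂.nc Q hQ Q' hQ' x y z w hxy hyz hzw h3.1 hz3.1 hy3.1 hw3.1
      · rcases eq_or_lt_of_le hy3.2 with h4 | h4
        · exact h₂.disj Q hQ Q' hQ' q h3.2 (h4 ▸ hy3.1)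
        · exact h₂.nc Q hQ Q' hQ' q y z w h4 hyz hzw h3.2 hz3.1 hy3.1 hw3.1

open Classical in
theorem sum_nxt (κ : ℕ → ℂ) (k : ℕ) (a q : α) (s : Finset α) (ha : ∀ x ∈ s, a < x) (hq : q ∈ s) :
    ∑ p ∈ (ncp (insert a s)).filter (Nxt a q), wt κ k a p
      = total κ 0 a (s.filter (· < q)) * total κ (k + 1) q (s.filter (q ≤ ·)) := by
  have has : a ∉ s := fun h => lt_irrefl _ (ha a h)
  have haq := ha q hq
  rw [total, total, Finset.sum_mul_sum, ← Finset.sum_product']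
  symm
  refine Finset.sum_bij' (fun x _ => x.1 ∪ x.2.image (ins a q))
    (fun p _ => (p.filter (· ⊆ s.filter (· < q)),
      (p.filter (¬ · ⊆ s.filter (· < q))).image (·.erase a))) ?_ ?_ ?_ ?_ ?_
  · rintro ⟨p₁, p₂⟩ hp
    simp only [Finset.mem_product, mem_ncp] at hp
    simp only [Finset.mem_filter, mem_ncp]
    refine ⟨isNC_glue ha hq hp.1 hp.2, ?_⟩
    obtain ⟨Q, hQ, hqQ⟩ := hp.2.cover q (by simp [hq])
    refine ⟨ins a q Q, Finset.mem_union_right _ (Finset.mem_image_of_mem _ hQ), ?_, ?_, haq.ne', ?_⟩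
    · simp [ins, hqQ]
    · simp [ins, hqQ]
    · intro x hx
      simp only [ins, hqQ, if_true, Finset.mem_insert] at hx
      exact hx.imp_right fun h => (Finset.mem_filter.1 (hp.2.sub Q hQ h)).2
  · intro p hp
    simp only [Finset.mem_filter, mem_ncp] at hp
    obtain ⟨hp, P₀, h0, ha0, hq0, hqa, hP0⟩ := hp
    have hbc := fun P hP hne => block_cases ha hp h0 ha0 hq0 hqa (P := P) hP hne
    have hP0n : ¬ P₀ ⊆ s.filter (· < q) := fun h => by
      have := h hq0
      simp at this
    have hsub : ∀ P ∈ p, ¬ P ⊆ s.filter (· < q) → P.erase a ⊆ s.filter (q ≤ ·) := by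
      intro P hP hn x hx
      rw [Finset.mem_erase] at hx
      by_cases h : P = P₀
      · subst h
        have h1 := hp.sub P hP hx.2
        have h2 := hP0 x hx.2
        grind
      · exact (hbc P hP h).resolve_left hn hx.2
    have hlift : ∀ P ∈ p, ¬ P ⊆ s.filter (· < q) → P = P₀ ∨ a ∉ P := by
      intro P hP hn
      by_cases h : P = P₀
      · exact Or.inl h
      · exact Or.inr fun haP => h (hp.disj P hP P₀ h0 a haP ha0)
    simp only [Finset.mem_product, mem_ncp]
    constructor
    · refine ⟨?_, ?_, ?_, ?_, ?_⟩
      · exact fun P hP => hp.ne P (Finset.mem_filter.1 hP).1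
      · exact fun P hP => (Finset.mem_filter.1 hP).2
      · intro x hx
        obtain ⟨hxs, hxq⟩ := Finset.mem_filter.1 hx
        obtain ⟨P, hP, hxP⟩ := hp.cover x (Finset.mem_insert_of_mem hxs)
        refine ⟨P, Finset.mem_filter.2 ⟨hP, ?_⟩, hxP⟩
        by_contra hn
        have := hsub P hP hn (Finset.mem_erase.2 ⟨(ha x hxs).ne', hxP⟩)
        exact absurd (Finset.mem_filter.1 this).2 (not_le.2 hxq)
      · exact fun P hP Q hQ => hp.disj P (Finset.mem_filter.1 hP).1 Q (Finset.mem_filter.1 hQ).1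
      · exact fun P hP Q hQ => hp.nc P (Finset.mem_filter.1 hP).1 Q (Finset.mem_filter.1 hQ).1
    · have key : ∀ P ∈ (p.filter (¬ · ⊆ s.filter (· < q))).image (·.erase a),
          ∃ Q ∈ p, ¬ Q ⊆ s.filter (· < q) ∧ P = Q.erase a := by
        intro P hP
        obtain ⟨Q, hQ, rfl⟩ := Finset.mem_image.1 hP
        exact ⟨Q, (Finset.mem_filter.1 hQ).1, (Finset.mem_filter.1 hQ).2, rfl⟩
      refine ⟨?_, ?_, ?_, ?_, ?_⟩
      · intro P hP
        obtain ⟨Q, hQ, hn, rfl⟩ := key P hP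
        obtain ⟨y, hy, hy'⟩ := Finset.not_subset.1 hn
        by_cases h : Q = P₀
        · subst h
          exact ⟨q, Finset.mem_erase.2 ⟨hqa, hq0⟩⟩
        · refine ⟨y, Finset.mem_erase.2 ⟨?_, hy⟩⟩
          rintro rfl
          exact h (hp.disj Q hQ P₀ h0 y hy ha0)
      · intro P hP
        obtain ⟨Q, hQ, hn, rfl⟩ := key P hP
        exact hsub Q hQ hn
      · intro x hx
        obtain ⟨hxs, hxq⟩ := Finset.mem_filter.1 hx
        obtain ⟨P, hP, hxP⟩ := hp.cover x (Finset.mem_insert_of_mem hxs)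
        refine ⟨P.erase a, Finset.mem_image_of_mem _ (Finset.mem_filter.2 ⟨hP, ?_⟩),
          Finset.mem_erase.2 ⟨(ha x hxs).ne', hxP⟩⟩
        intro hn
        exact absurd (Finset.mem_filter.1 (hn hxP)).2 (not_lt.2 hxq)
      · intro P hP P' hP' x hx hx'
        obtain ⟨Q, hQ, hn, rfl⟩ := key P hP
        obtain ⟨Q', hQ', hn', rfl⟩ := key P' hP'
        rw [hp.disj Q hQ Q' hQ' x (Finset.mem_of_mem_erase hx) (Finset.mem_of_mem_erase hx')]
      · intro P hP P' hP' x y z w hxy hyz hzw hx hz hy hw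
        obtain ⟨Q, hQ, hn, rfl⟩ := key P hP
        obtain ⟨Q', hQ', hn', rfl⟩ := key P' hP'
        rw [hp.nc Q hQ Q' hQ' x y z w hxy hyz hzw (Finset.mem_of_mem_erase hx)
          (Finset.mem_of_mem_erase hz) (Finset.mem_of_mem_erase hy) (Finset.mem_of_mem_erase hw)]
  · rintro ⟨p₁, p₂⟩ hp
    simp only [Finset.mem_product, mem_ncp] at hp
    obtain ⟨h₁, h₂⟩ := hp
    have hA : ∀ Q ∈ p₂, a ∉ Q := fun Q hQ h => has (Finset.mem_filter.1 (h₂.sub Q hQ h)).1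
    have hn : ∀ Q ∈ p₂, ¬ ins a q Q ⊆ s.filter (· < q) := by
      intro Q hQ h
      obtain ⟨x, hx⟩ := h₂.ne Q hQ
      have h3 : x ∈ ins a q Q := by
        unfold ins
        split_ifs <;> simp [hx]
      exact absurd (Finset.mem_filter.1 (h h3)).2
        (not_lt.2 (Finset.mem_filter.1 (h₂.sub Q hQ hx)).2)
    have hsub := h₁.sub
    have e1 : (p₁ ∪ p₂.image (ins a q)).filter (· ⊆ s.filter (· < q)) = p₁ := by
      ext P
      simp only [Finset.mem_filter, Finset.mem_union, Finset.mem_image]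
      constructor
      · rintro ⟨h | ⟨Q, hQ, rfl⟩, h'⟩
        · exact h
        · exact absurd h' (hn Q hQ)
      · exact fun h => ⟨Or.inl h, hsub P h⟩
    have e2 : (p₁ ∪ p₂.image (ins a q)).filter (¬ · ⊆ s.filter (· < q)) = p₂.image (ins a q) := by
      ext P
      simp only [Finset.mem_filter, Finset.mem_union, Finset.mem_image]
      constructor
      · rintro ⟨h | h, h'⟩
        · exact absurd (hsub P h) h'
        · exact h
      · rintro ⟨Q, hQ, rfl⟩
        exact ⟨Or.inr ⟨Q, hQ, rfl⟩, hn Q hQ⟩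
    refine Prod.ext e1 ?_
    simp only
    rw [e2, Finset.image_image]
    conv_rhs => rw [← Finset.image_id (s := p₂)]
    exact Finset.image_congr fun Q hQ => erase_ins (hA Q hQ)
  · intro p hp
    simp only [Finset.mem_filter, mem_ncp] at hp
    obtain ⟨hp, P₀, h0, ha0, hq0, hqa, hP0⟩ := hp
    have hP0n : ¬ P₀ ⊆ s.filter (· < q) := fun h => by
      have := h hq0
      simp at this
    have e : ((p.filter (¬ · ⊆ s.filter (· < q))).image (·.erase a)).image (ins a q)
        = p.filter (¬ · ⊆ s.filter (· < q)) := by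
      rw [Finset.image_image]
      conv_rhs => rw [← Finset.image_id (s := p.filter (¬ · ⊆ s.filter (· < q)))]
      refine Finset.image_congr fun Q hQ => ?_
      have hQ1 := (Finset.mem_filter.1 (Finset.mem_coe.1 hQ)).1
      simp only [Function.comp, id, ins]
      by_cases h : Q = P₀
      · subst h
        rw [if_pos (Finset.mem_erase.2 ⟨hqa, hq0⟩), Finset.insert_erase ha0]
      · have h1 : a ∉ Q := fun h' => h (hp.disj Q hQ1 P₀ h0 a h' ha0)
        have h2 : q ∉ Q := fun h' => h (hp.disj Q hQ1 P₀ h0 q h' hq0)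
        rw [Finset.erase_eq_of_notMem h1, if_neg h2]
    simp only
    rw [e, Finset.filter_union_filter_not_eq]
  · rintro ⟨p₁, p₂⟩ hp
    simp only [Finset.mem_product, mem_ncp] at hp
    obtain ⟨h₁, h₂⟩ := hp
    have hA : ∀ Q ∈ p₂, a ∉ Q := fun Q hQ h => has (Finset.mem_filter.1 (h₂.sub Q hQ h)).1
    have hA1 : ∀ Q ∈ p₁, a ∉ Q := fun Q hQ h => has (Finset.mem_filter.1 (h₁.sub Q hQ h)).1
    have hdis : Disjoint p₁ (p₂.image (ins a q)) := by
      rw [Finset.disjoint_left]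
      intro P hP hP'
      obtain ⟨Q, hQ, rfl⟩ := Finset.mem_image.1 hP'
      obtain ⟨x, hx⟩ := h₂.ne Q hQ
      have h3 : x ∈ ins a q Q := by
        unfold ins
        split_ifs <;> simp [hx]
      exact absurd (Finset.mem_filter.1 (h₁.sub _ hP h3)).2
        (not_lt.2 (Finset.mem_filter.1 (h₂.sub Q hQ hx)).2)
    simp only [wt]
    rw [Finset.prod_union hdis, Finset.prod_image]
    · congr 1
      · refine Finset.prod_congr rfl fun P hP => ?_
        simp [hA1 P hP]
      · refine Finset.prod_congr rfl fun Q hQ => ?_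
        unfold ins
        split_ifs with h1 h2 h3
        · rw [Finset.card_insert_of_notMem (hA Q hQ)]
          congr 1
          ring
        · simp at h2
        · exact absurd h3 (hA Q hQ)
        · rfl
    · intro Q hQ Q' hQ' h
      rw [← erase_ins (q := q) (hA Q hQ), h, erase_ins (hA Q' hQ')]

open Classical in
theorem total_insert (κ : ℕ → ℂ) (k : ℕ) (a : α) (s : Finset α) (ha : ∀ x ∈ s, a < x) :
    total κ k a (insert a s) = κ (1 + k) * total κ 0 a s +
      ∑ q ∈ s, total κ 0 a (s.filter (· < q)) * total κ (k + 1) q (s.filter (q ≤ ·)) := by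
  have has : a ∉ s := fun h => lt_irrefl _ (ha a h)
  rw [← sum_singleton κ k a s ha, ← Finset.sum_congr rfl (fun q hq => sum_nxt κ k a q s ha hq),
    ← Finset.sum_biUnion, ← Finset.sum_union, total]
  · refine Finset.sum_congr ?_ fun _ _ => rfl
    ext p
    simp only [Finset.mem_union, Finset.mem_filter, Finset.mem_biUnion]
    constructor
    · intro hp
      have h := mem_ncp.1 hp
      obtain ⟨P, hP, haP⟩ := h.cover a (Finset.mem_insert_self _ _)
      by_cases hs : (P.erase a).Nonempty
      · refine Or.inr ⟨(P.erase a).min' hs, ?_, hp, P, hP, haP, ?_, ?_, ?_⟩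
        · have := (P.erase a).min'_mem hs
          rw [Finset.mem_erase] at this
          exact (Finset.mem_insert.1 (h.sub P hP this.2)).resolve_left this.1
        · exact Finset.mem_of_mem_erase ((P.erase a).min'_mem hs)
        · exact Finset.ne_of_mem_erase ((P.erase a).min'_mem hs)
        · intro x hx
          by_cases hxa : x = a
          · exact Or.inl hxa
          · exact Or.inr (Finset.min'_le _ _ (Finset.mem_erase.2 ⟨hxa, hx⟩))
      · left
        refine ⟨hp, ?_⟩
        rw [Finset.not_nonempty_iff_eq_empty] at hs
        have : P = {a} := by rw [← Finset.insert_erase haP, hs]; rfl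
        rwa [← this]
    · rintro (h | ⟨q, -, h⟩) <;> exact h.1
  · rw [Finset.disjoint_left]
    intro p hp hp'
    simp only [Finset.mem_filter, Finset.mem_biUnion, mem_ncp] at hp hp'
    obtain ⟨q, hq, h, P, hP, haP, hqP, hqa, -⟩ := hp'
    have := h.disj P hP {a} hp.2 a haP (Finset.mem_singleton_self a)
    subst this
    exact hqa (Finset.mem_singleton.1 hqP)
  · intro q hq q' hq' hne
    rw [Function.onFun, Finset.disjoint_left]
    intro p hp hp'
    simp only [Finset.mem_filter, mem_ncp] at hp hp'
    obtain ⟨h, P, hP, haP, hqP, hqa, hm⟩ := hp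
    obtain ⟨-, P', hP', haP', hqP', hqa', hm'⟩ := hp'
    have := h.disj P hP P' hP' a haP haP'
    subst this
    exact hne (le_antisymm ((hm q' hqP').resolve_left hqa') ((hm' q hqP).resolve_left hqa))

/-- The total weight of the non-crossing partitions of an `m`-element set, the size of the block
of the minimum being increased by `k`. -/
noncomputable def totalSeq (κ : ℕ → ℂ) : ℕ → ℕ → ℂ
  | _, 0 => 1
  | k, m + 1 => κ (1 + k) * totalSeq κ 0 m +
      ∑ j ∈ (Finset.range m).attach, totalSeq κ 0 j.1 * totalSeq κ (k + 1) (m - j.1)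
termination_by _ m => m
decreasing_by
  · exact Nat.lt_succ_self m
  · exact Nat.lt_succ_of_lt (Finset.mem_range.1 j.2)
  · omega

theorem totalSeq_zero (κ : ℕ → ℂ) (k : ℕ) : totalSeq κ k 0 = 1 := by
  rw [totalSeq]

theorem totalSeq_succ (κ : ℕ → ℂ) (k m : ℕ) : totalSeq κ k (m + 1) = κ (1 + k) * totalSeq κ 0 m +
      ∑ j ∈ Finset.range m, totalSeq κ 0 j * totalSeq κ (k + 1) (m - j) := by
  rw [totalSeq, ← Finset.sum_attach (Finset.range m)]

theorem sum_rank (s : Finset α) (f : ℕ → ℂ) :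
    ∑ q ∈ s, f (s.filter (· < q)).card = ∑ j ∈ Finset.range s.card, f j := by
  induction s using Finset.induction_on_max with
  | empty => simp
  | insert M t hM ih =>
    have hMt : M ∉ t := fun h => lt_irrefl _ (hM M h)
    rw [Finset.sum_insert hMt, Finset.card_insert_of_notMem hMt, Finset.sum_range_succ, ← ih,
      add_comm]
    congr 1
    · refine Finset.sum_congr rfl fun q hq => ?_
      rw [Finset.filter_insert, if_neg (not_lt.2 (hM q hq).le)]
    · rw [Finset.filter_insert, if_neg (lt_irrefl M), Finset.filter_true_of_mem hM]

theorem total_eq_totalSeq (κ : ℕ → ℂ) (n : ℕ) : ∀ (k : ℕ) (s : Finset α) (a : α), s.card = n →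
    (∀ x ∈ s, a ≤ x) → (s.Nonempty → a ∈ s) → total κ k a s = totalSeq κ k n := by
  induction n using Nat.strong_induction_on with
  | _ n ih =>
    intro k s a hs ha hmem
    rcases s.eq_empty_or_nonempty with rfl | hne
    · rw [← hs, Finset.card_empty, total_empty, totalSeq_zero]
    obtain ⟨m, rfl⟩ : ∃ m, n = m + 1 :=
      ⟨n - 1, by have := Finset.card_pos.2 hne; omega⟩
    have has := hmem hne
    obtain ⟨t, hat, rfl⟩ : ∃ t, a ∉ t ∧ insert a t = s :=
      ⟨s.erase a, Finset.notMem_erase a s, Finset.insert_erase has⟩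
    have hlt : ∀ x ∈ t, a < x := fun x hx =>
      lt_of_le_of_ne (ha x (Finset.mem_insert_of_mem hx)) (by rintro rfl; exact hat hx)
    rw [Finset.card_insert_of_notMem hat, Nat.add_right_cancel_iff] at hs
    have h0 : ∀ (u : Finset α), u.card < m + 1 → total κ 0 a u = totalSeq κ 0 u.card := by
      intro u hu
      rcases u.eq_empty_or_nonempty with rfl | hu'
      · rw [total_empty, Finset.card_empty, totalSeq_zero]
      · rw [total_zero κ a (u.min' hu')]
        exact ih _ hu 0 u _ rfl (fun x hx => Finset.min'_le _ _ hx) fun _ => Finset.min'_mem _ _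
    rw [total_insert κ k a t hlt, totalSeq_succ, h0 t (by omega), hs]
    congr 1
    rw [← hs, ← sum_rank t (fun j => totalSeq κ 0 j * totalSeq κ (k + 1) (t.card - j))]
    refine Finset.sum_congr rfl fun q hq => ?_
    have hc : (t.filter (q ≤ ·)).card = t.card - (t.filter (· < q)).card := by
      have := Finset.card_filter_add_card_filter_not (s := t) (fun x => x < q)
      simp only [not_lt] at this
      omega
    have hle := Finset.card_filter_le t (· < q)
    have hlt' : (t.filter (q ≤ ·)).card < m + 1 := by rw [hc]; omega
    rw [h0 _ (by omega), ← hc]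
    congr 1
    convert ih _ hlt' (k + 1) _ q rfl (fun x hx => (Finset.mem_filter.1 hx).2)
      (fun _ => Finset.mem_filter.2 ⟨hq, le_rfl⟩)

end NCPart

namespace NCPart
open PowerSeries

theorem eq_zero_of_X_pow_dvd {f : PowerSeries ℂ} (h : ∀ K, (X : PowerSeries ℂ) ^ K ∣ f) : f = 0 := by
  ext n
  exact X_pow_dvd_iff.1 (h (n + 1)) n (Nat.lt_succ_self n)

theorem mk_totalSeq_eq_subst (κ : ℕ → ℂ) (h0 : κ 0 = 0) :
    PowerSeries.mk (totalSeq κ 0) - 1 = (PowerSeries.mk κ).subst (X * PowerSeries.mk (totalSeq κ 0)) := by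
  set A := PowerSeries.mk (totalSeq κ 0) with hA
  set y : PowerSeries ℂ := X * A with hy
  have hs : HasSubst y := HasSubst.of_constantCoeff_zero' (by simp [hy])
  have hF : ∀ k, PowerSeries.mk (totalSeq κ k) - 1 =
      C (κ (1 + k)) * y + y * (PowerSeries.mk (totalSeq κ (k + 1)) - 1) := by
    intro k
    ext n
    cases n with
    | zero => simp [hy, totalSeq_zero]
    | succ m =>
      have e : C (κ (1 + k)) * y + y * (PowerSeries.mk (totalSeq κ (k + 1)) - 1)
          = X * (C (κ (1 + k)) * A + A * (PowerSeries.mk (totalSeq κ (k + 1)) - 1)) := by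
        rw [hy]; ring
      rw [e, coeff_succ_X_mul, map_add, coeff_C_mul, map_sub, coeff_mk, totalSeq_succ, coeff_mul,
        Finset.Nat.sum_antidiagonal_eq_sum_range_succ_mk, Finset.sum_range_succ]
      simp only [hA, coeff_mk, map_sub, coeff_one, Nat.sub_self, totalSeq_zero]
      simp only [Nat.succ_ne_zero, if_false, sub_zero, if_true, sub_self, mul_zero, add_zero]
      congr 1
      refine Finset.sum_congr rfl fun j hj => ?_
      have := Finset.mem_range.1 hj
      rw [if_neg (by omega), sub_zero]
  have hG : ∀ k, (X * PowerSeries.mk (fun j => κ (1 + k + j))).subst y =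
      C (κ (1 + k)) * y + y * (X * PowerSeries.mk (fun j => κ (1 + (k + 1) + j))).subst y := by
    intro k
    have e : X * PowerSeries.mk (fun j => κ (1 + k + j)) =
        C (κ (1 + k)) * X + X * (X * PowerSeries.mk (fun j => κ (1 + (k + 1) + j))) := by
      ext n
      cases n with
      | zero => simp
      | succ n =>
        cases n with
        | zero => simp [mul_comm (C (κ (1 + k)))]
        | succ n =>
          rw [map_add, coeff_C_mul, coeff_succ_X_mul, coeff_succ_X_mul, coeff_succ_X_mul,
            coeff_mk, coeff_mk, coeff_X, if_neg (by omega)]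
          rw [mul_zero, zero_add]
          congr 1
          ring
    conv_lhs => rw [e]
    rw [subst_add hs, subst_mul hs, subst_mul hs (X : PowerSeries ℂ), subst_X hs]
    congr 2
    exact subst_C _
  set Δ : ℕ → PowerSeries ℂ := fun k => (PowerSeries.mk (totalSeq κ k) - 1) -
    (X * PowerSeries.mk (fun j => κ (1 + k + j))).subst y with hΔ
  have hrec : ∀ k, Δ k = y * Δ (k + 1) := by
    intro k
    simp only [hΔ]
    rw [hF k, hG k]
    ring
  have hpow : ∀ K, Δ 0 = y ^ K * Δ K := by
    intro K
    induction K with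
    | zero => simp
    | succ K ih => rw [ih, hrec K]; ring
  have hz : Δ 0 = 0 := by
    refine eq_zero_of_X_pow_dvd fun K => ?_
    rw [hpow K, hy, mul_pow, mul_assoc]
    exact dvd_mul_right _ _
  have e0 : X * PowerSeries.mk (fun j => κ (1 + 0 + j)) = PowerSeries.mk κ := by
    ext n
    cases n with
    | zero => simp [h0]
    | succ n => rw [coeff_succ_X_mul, coeff_mk, coeff_mk]; congr 1; ring
  have := sub_eq_zero.1 hz
  rwa [e0] at this

/-- The free cumulants of the limit distribution. -/
noncomputable def kappa (b j : ℕ) : ℂ :=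
  if Even j ∧ j ≠ 0 then
    (b : ℂ) ^ ((2 : ℤ) - (j : ℤ)) * (-1) ^ (j / 2 - 1) * (catalan (j / 2 - 1) : ℂ)
  else 0

theorem mk_kappa (b : ℕ) (hb : 0 < b) :
    PowerSeries.mk (kappa b) = X ^ 2 - C (((b : ℂ) ^ 2)⁻¹) * PowerSeries.mk (kappa b) ^ 2 := by
  have hb' : (b : ℂ) ≠ 0 := Nat.cast_ne_zero.2 hb.ne'
  set c := ((b : ℂ) ^ 2)⁻¹ with hc
  set Cat := PowerSeries.map (Nat.castRingHom ℂ) catalanSeries with hCat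
  have h1 : Cat = 1 + X * Cat ^ 2 := by
    have := congrArg (PowerSeries.map (Nat.castRingHom ℂ)) catalanSeries_sq_mul_X_add_one
    simp only [map_add, map_mul, map_pow, map_one, PowerSeries.map_X] at this
    rw [← hCat] at this
    linear_combination -this
  set H := expand 2 two_ne_zero (rescale (-c) Cat) with hH
  have h2 : H = 1 - C c * X ^ 2 * H ^ 2 := by
    have := congrArg (fun f => expand 2 two_ne_zero (rescale (-c) f)) h1
    simp only [map_add, map_mul, map_pow, map_one, rescale_X, expand_X, expand_C] at this
    rw [← hH] at this
    rw [map_neg] at this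
    linear_combination this
  have h3 : PowerSeries.mk (kappa b) = X ^ 2 * H := by
    ext n
    rw [coeff_mk, coeff_X_pow_mul', hH]
    unfold kappa
    by_cases hn : Even n ∧ n ≠ 0
    · obtain ⟨r, rfl⟩ : ∃ r, n = 2 * (r + 1) := by
        obtain ⟨⟨r, rfl⟩, h⟩ := hn
        exact ⟨r - 1, by omega⟩
      rw [if_pos hn, if_pos (by omega), show 2 * (r + 1) - 2 = 2 * r by omega, coeff_expand_mul,
        coeff_rescale, hCat, coeff_map, catalanSeries_coeff]
      rw [show 2 * (r + 1) / 2 - 1 = r by omega]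
      congr 1
      rw [neg_pow c, mul_comm, hc]
      congr 1
      push_cast
      rw [show (2 : ℤ) - 2 * (r + 1) = -(2 * r : ℕ) by push_cast; ring, _root_.zpow_neg, zpow_natCast,
        inv_pow, pow_mul]
    · rw [if_neg hn]
      split_ifs with h
      · rw [coeff_expand_of_not_dvd]
        intro hd
        apply hn
        rw [even_iff_two_dvd]
        omega
      · rfl
  rw [h3]
  linear_combination X ^ 2 * h2

/-- The limit moments. -/
noncomputable def mom (b n : ℕ) : ℂ := totalSeq (kappa b) 0 (2 * n)

theorem mom_zero (b : ℕ) : mom b 0 = 1 := totalSeq_zero _ _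

theorem mom_succ (b : ℕ) (hb : 0 < b) (k : ℕ) :
    mom b (k + 1) = ∑ j ∈ Finset.range (k + 1), mom b j * mom b (k - j)
      - ((b : ℂ) ^ 2)⁻¹ * ∑ j ∈ Finset.range k, mom b (j + 1) * mom b (k - j) := by
  set c := ((b : ℂ) ^ 2)⁻¹ with hc
  set a := totalSeq (kappa b) 0 with ha
  set A := PowerSeries.mk a with hA
  have hκ0 : kappa b 0 = 0 := by simp [kappa]
  have hs : HasSubst (X * A) := HasSubst.of_constantCoeff_zero' (by simp)
  have hq : A - 1 = (X * A) ^ 2 - C c * (A - 1) ^ 2 := by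
    have h1 := mk_totalSeq_eq_subst (kappa b) hκ0
    rw [← ha, ← hA] at h1
    conv_lhs => rw [h1, mk_kappa b hb]
    rw [subst_sub hs, subst_mul hs, subst_pow hs, subst_pow hs, subst_X hs, ← h1]
    congr 2
    exact subst_C _
  have hodd : ∀ n, ¬ Even n → a n = 0 := by
    intro n
    induction n using Nat.strong_induction_on with
    | _ n ih =>
      intro hn
      have h := congrArg (coeff n) hq
      rw [map_sub, coeff_one, if_neg (by rintro rfl; simp at hn), sub_zero, map_sub, coeff_C_mul,
        mul_pow, coeff_X_pow_mul', sq (A - 1), sq A] at h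
      rw [hA, coeff_mk] at h
      rw [h]
      have e1 : (if 2 ≤ n then (coeff (n - 2)) (PowerSeries.mk a * PowerSeries.mk a) else 0) = 0 := by
        split_ifs with h2
        · rw [coeff_mul]
          refine Finset.sum_eq_zero fun x hx => ?_
          have := Finset.HasAntidiagonal.mem_antidiagonal.1 hx
          simp only [coeff_mk]
          by_cases h4 : Even x.1
          · rw [ih x.2 (by omega) (by grind), mul_zero]
          · rw [ih x.1 (by omega) h4, zero_mul]
        · rfl
      have e2 : ∑ p ∈ Finset.HasAntidiagonal.antidiagonal n, (coeff p.1) (PowerSeries.mk a - 1) *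
          (coeff p.2) (PowerSeries.mk a - 1) = 0 := by
        refine Finset.sum_eq_zero fun x hx => ?_
        have := Finset.HasAntidiagonal.mem_antidiagonal.1 hx
        simp only [map_sub, coeff_mk, coeff_one]
        have ha0 : a 0 = 1 := totalSeq_zero _ _
        by_cases h1 : x.1 = 0
        · simp [h1, ha0]
        by_cases h2 : x.2 = 0
        · simp [h2, ha0]
        simp only [h1, h2, if_false, sub_zero]
        by_cases h4 : Even x.1
        · rw [ih x.2 (by omega) (by grind), mul_zero]
        · rw [ih x.1 (by omega) h4, zero_mul]
      rw [e1, coeff_mul, e2, mul_zero, sub_zero]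
  set B := PowerSeries.mk (mom b) with hB
  have hAB : A = expand 2 two_ne_zero B := by
    ext n
    by_cases h : 2 ∣ n
    · obtain ⟨r, rfl⟩ := h
      rw [coeff_expand_mul, hA, hB, coeff_mk, coeff_mk]
      rfl
    · rw [coeff_expand_of_not_dvd _ _ _ h, hA, coeff_mk]
      exact hodd n (by rwa [even_iff_two_dvd])
  have hqB : B - 1 = X * B ^ 2 - C c * (B - 1) ^ 2 := by
    have h : expand 2 two_ne_zero (B - 1) = expand 2 two_ne_zero (X * B ^ 2 - C c * (B - 1) ^ 2) := by
      simp only [map_sub, map_mul, map_pow, map_one, expand_X, expand_C, ← hAB]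
      rw [← mul_pow]
      exact hq
    ext n
    have := congrArg (coeff (2 * n)) h
    rwa [coeff_expand_mul, coeff_expand_mul] at this
  set B1 := PowerSeries.mk (fun j => mom b (j + 1)) with hB1
  have hBB : B - 1 = X * B1 := by
    ext n
    cases n with
    | zero => simp [hB, mom_zero]
    | succ n => simp [hB, hB1, coeff_succ_X_mul, coeff_one]
  rw [hBB] at hqB
  have h := congrArg (coeff (k + 1)) hqB
  rw [coeff_succ_X_mul, map_sub, coeff_succ_X_mul, coeff_C_mul, mul_pow, coeff_X_pow_mul',
    hB1, coeff_mk, sq B, coeff_mul, Finset.Nat.sum_antidiagonal_eq_sum_range_succ_mk] at h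
  rw [h]
  congr 1
  · simp [hB]
  · congr 1
    cases k with
    | zero => simp
    | succ k =>
      rw [if_pos (by omega), show k + 1 + 1 - 2 = k by omega, sq, coeff_mul,
        Finset.Nat.sum_antidiagonal_eq_sum_range_succ_mk]
      refine Finset.sum_congr rfl fun j hj => ?_
      have := Finset.mem_range.1 hj
      simp only [coeff_mk]
      rw [show k - j + 1 = k + 1 - j by omega]

theorem ncEven_iff (n : ℕ) (π : Finpartition (Finset.univ : Finset (Fin (2 * n)))) :
    NCEven n π ↔ (∀ P ∈ π.parts, Even P.card) ∧ IsNC Finset.univ π.parts := by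
  constructor
  · rintro ⟨h1, h2⟩
    refine ⟨h1, ⟨?_, ?_, ?_, ?_, ?_⟩⟩
    · exact fun P hP => π.nonempty_of_mem_parts hP
    · exact fun P _ => Finset.subset_univ P
    · exact fun x hx => π.exists_mem hx
    · exact fun P hP Q hQ x hx hx' => π.eq_of_mem_parts hP hQ hx hx'
    · intro P hP Q hQ a b c d hab hbc hcd ha hc hb hd
      by_contra hne
      exact h2 ⟨P, hP, Q, hQ, hne, a, b, c, d, hab, hbc, hcd, ha, hc, hb, hd⟩
  · rintro ⟨h1, h2⟩
    refine ⟨h1, ?_⟩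
    rintro ⟨P, hP, Q, hQ, hne, a, b, c, d, hab, hbc, hcd, ha, hc, hb, hd⟩
    exact hne (h2.nc P hP Q hQ a b c d hab hbc hcd ha hc hb hd)

theorem finsum_eq_mom (b n : ℕ) (hn : 0 < n) :
    (∑ᶠ (π : Finpartition (Finset.univ : Finset (Fin (2 * n)))) (_ : NCEven n π), ∏ P ∈ π.parts,
      (b : ℂ) ^ ((2 : ℤ) - (P.card : ℤ)) * (-1) ^ (P.card / 2 - 1) *
        (catalan (P.card / 2 - 1) : ℂ)) = mom b n := by
  classical
  have ht : mom b n = total (kappa b) 0 (⟨0, by omega⟩ : Fin (2 * n)) Finset.univ := by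
    rw [total_eq_totalSeq (kappa b) (2 * n) 0 _ _ (by simp) (fun x _ => Fin.le_def.2 (Nat.zero_le _))
      (fun _ => Finset.mem_univ _)]
    rfl
  have hterm : ∀ π : Finpartition (Finset.univ : Finset (Fin (2 * n))),
      (if NCEven n π then ∏ P ∈ π.parts, (b : ℂ) ^ ((2 : ℤ) - (P.card : ℤ)) *
        (-1) ^ (P.card / 2 - 1) * (catalan (P.card / 2 - 1) : ℂ) else 0) =
      if IsNC Finset.univ π.parts then ∏ P ∈ π.parts, kappa b P.card else 0 := by
    intro π
    simp only [ncEven_iff]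
    by_cases h : IsNC Finset.univ π.parts
    · by_cases h' : ∀ P ∈ π.parts, Even P.card
      · rw [if_pos ⟨h', h⟩, if_pos h]
        refine Finset.prod_congr rfl fun P hP => ?_
        rw [kappa, if_pos ⟨h' P hP, (Finset.card_pos.2 (h.ne P hP)).ne'⟩]
      · rw [if_neg (fun h3 => h' h3.1), if_pos h]
        push Not at h'
        obtain ⟨P, hP, hodd⟩ := h'
        refine (Finset.prod_eq_zero hP ?_).symm
        rw [kappa, if_neg fun h => hodd h.1]
    · rw [if_neg h, if_neg (fun h3 => h h3.2)]
  rw [ht, total, finsum_eq_sum_of_fintype]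
  simp only [finsum_eq_if, hterm]
  rw [← Finset.sum_filter]
  refine Finset.sum_bij (fun π _ => π.parts) ?_ ?_ ?_ ?_
  · intro π hπ
    exact mem_ncp.2 (Finset.mem_filter.1 hπ).2
  · intro π _ π' _ h
    exact Finpartition.ext h
  · intro p hp
    have h := mem_ncp.1 hp
    refine ⟨⟨p, ?_, ?_, ?_⟩, ?_, rfl⟩
    · rw [Finset.supIndep_iff_pairwiseDisjoint]
      intro P hP Q hQ hne
      rw [Function.onFun, id, id, Finset.disjoint_left]
      exact fun x hx hx' => hne (h.disj P hP Q hQ x hx hx')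
    · ext x
      simpa using h.cover x (Finset.mem_univ x)
    · intro hb
      exact Finset.not_nonempty_empty (h.ne _ hb)
    · simpa using h
  · intro π _
    simp [wt]

end NCPart

namespace HaarLoop

open MvPolynomial

variable {M : ℕ}

/-- Polynomials in the entries of a matrix (flag `false`) and their conjugates (flag `true`). -/
abbrev UPoly (M : ℕ) := MvPolynomial ((Fin M × Fin M) × Bool) ℂ

/-- Evaluation of a polynomial at a matrix and its entrywise conjugate. -/
noncomputable def ev (U : Matrix (Fin M) (Fin M) ℂ) : UPoly M →ₐ[ℂ] ℂ :=
  aeval fun v => if v.2 then star (U v.1.1 v.1.2) else U v.1.1 v.1.2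

theorem ev_X_false (U : Matrix (Fin M) (Fin M) ℂ) (i j : Fin M) :
    ev U (X ((i, j), false)) = U i j := by simp [ev]

theorem ev_X_true (U : Matrix (Fin M) (Fin M) ℂ) (i j : Fin M) :
    ev U (X ((i, j), true)) = star (U i j) := by simp [ev]

theorem ev_C (U : Matrix (Fin M) (Fin M) ℂ) (c : ℂ) : ev U (C c) = c := by simp [ev]

/-- The derivation induced by the flow `U ↦ exp (t A) U`, for skew-Hermitian `A`. -/
noncomputable def lieD (A : Matrix (Fin M) (Fin M) ℂ) : Derivation ℂ (UPoly M) (UPoly M) :=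
  mkDerivation ℂ fun v =>
    if v.2 then ∑ k, C (-(A k v.1.1)) * X ((k, v.1.2), true)
    else ∑ k, C (A v.1.1 k) * X ((k, v.1.2), false)

theorem lieD_X_false (A : Matrix (Fin M) (Fin M) ℂ) (i j : Fin M) :
    lieD A (X ((i, j), false)) = ∑ k, C (A i k) * X ((k, j), false) := by
  simp [lieD, mkDerivation_X]

theorem lieD_X_true (A : Matrix (Fin M) (Fin M) ℂ) (i j : Fin M) :
    lieD A (X ((i, j), true)) = ∑ k, C (-(A k i)) * X ((k, j), true) := by
  simp [lieD, mkDerivation_X]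

theorem lieD_add_smul (A B : Matrix (Fin M) (Fin M) ℂ) (c : ℂ) :
    lieD (A + c • B) = lieD A + c • lieD B := by
  apply MvPolynomial.derivation_ext
  rintro ⟨⟨i, j⟩, _ | _⟩
  · rw [Derivation.add_apply, Derivation.smul_apply, lieD_X_false, lieD_X_false, lieD_X_false,
      Finset.smul_sum, ← Finset.sum_add_distrib]
    refine Finset.sum_congr rfl fun k _ => ?_
    simp only [Matrix.add_apply, Matrix.smul_apply, smul_eq_mul, C_add, C_mul, smul_eq_C_mul]
    ring
  · rw [Derivation.add_apply, Derivation.smul_apply, lieD_X_true, lieD_X_true, lieD_X_true,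
      Finset.smul_sum, ← Finset.sum_add_distrib]
    refine Finset.sum_congr rfl fun k _ => ?_
    simp only [Matrix.add_apply, Matrix.smul_apply, smul_eq_mul, C_add, C_mul, smul_eq_C_mul,
      neg_add, C_neg]
    ring

theorem hasDerivAt_ev (A : Matrix (Fin M) (Fin M) ℂ) (hA : Aᴴ = -A)
    (V : ℝ → Matrix (Fin M) (Fin M) ℂ) (t : ℝ)
    (hV : ∀ i j, HasDerivAt (fun s => V s i j) ((A * V t) i j) t) (p : UPoly M) :
    HasDerivAt (fun s => ev (V s) p) (ev (V t) (lieD A p)) t := by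
  induction p using MvPolynomial.induction_on with
  | C a =>
    simp only [← MvPolynomial.algebraMap_eq, Derivation.map_algebraMap, map_zero,
      AlgHom.commutes]
    exact hasDerivAt_const _ _
  | add p q hp hq =>
    simp only [map_add]
    exact hp.add hq
  | mul_X p v hp =>
    have hX : HasDerivAt (fun s => ev (V s) (X v)) (ev (V t) (lieD A (X v))) t := by
      obtain ⟨⟨i, j⟩, _ | _⟩ := v
      · rw [lieD_X_false]
        simp only [ev_X_false, map_sum, map_mul, ev_C]
        exact hV i j
      · rw [lieD_X_true]
        simp only [ev_X_true, map_sum, map_mul, ev_C]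
        refine (hV i j).star.congr_deriv ?_
        rw [Matrix.mul_apply, star_sum]
        refine Finset.sum_congr rfl fun k _ => ?_
        rw [star_mul', ← Matrix.conjTranspose_apply A, hA, Matrix.neg_apply]
    simp only [map_mul, Derivation.leibniz, map_add, smul_eq_mul]
    exact (hp.mul hX).congr_deriv (by ring)

theorem exists_bound_ev (p : UPoly M) :
    ∃ K : ℝ, ∀ U ∈ Matrix.unitaryGroup (Fin M) ℂ, ‖ev U p‖ ≤ K := by
  induction p using MvPolynomial.induction_on with
  | C a => exact ⟨‖a‖, fun U _ => by rw [ev_C]⟩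
  | add p q hp hq =>
    obtain ⟨K, hK⟩ := hp
    obtain ⟨L, hL⟩ := hq
    exact ⟨K + L, fun U hU => by
      rw [map_add]; exact (norm_add_le _ _).trans (add_le_add (hK U hU) (hL U hU))⟩
  | mul_X p v hp =>
    obtain ⟨K, hK⟩ := hp
    refine ⟨K, fun U hU => ?_⟩
    have h1 : ‖ev U (X v)‖ ≤ 1 := by
      obtain ⟨⟨i, j⟩, _ | _⟩ := v
      · rw [ev_X_false]; exact entry_norm_bound_of_unitary hU i j
      · rw [ev_X_true, norm_star]; exact entry_norm_bound_of_unitary hU i j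
    rw [map_mul, norm_mul]
    exact (mul_le_of_le_one_right (norm_nonneg _) h1).trans (hK U hU)

theorem measurable_entry (i j : Fin M) :
    Measurable fun U : Matrix (Fin M) (Fin M) ℂ => U i j :=
  (measurable_pi_apply (X := fun _ : Fin M => ℂ) j).comp
    (measurable_pi_apply (X := fun _ : Fin M => Fin M → ℂ) i)

theorem measurable_ev (p : UPoly M) : Measurable fun U => ev U p := by
  induction p using MvPolynomial.induction_on with
  | C a => simp only [ev_C]; exact measurable_const
  | add p q hp hq => simp only [map_add]; exact hp.add hq
  | mul_X p v hp =>
    simp only [map_mul]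
    refine hp.mul ?_
    obtain ⟨⟨i, j⟩, _ | _⟩ := v
    · simp only [ev_X_false]; exact measurable_entry i j
    · simp only [ev_X_true]; exact continuous_star.measurable.comp (measurable_entry i j)

theorem measurable_mul_left (V : Matrix (Fin M) (Fin M) ℂ) :
    Measurable fun U : Matrix (Fin M) (Fin M) ℂ => V * U := by
  refine measurable_pi_lambda (X := fun _ : Fin M => Fin M → ℂ) _ fun i =>
    measurable_pi_lambda (X := fun _ : Fin M => ℂ) _ fun j => ?_
  simp only [Matrix.mul_apply]
  exact Finset.measurable_sum _ fun k _ => (measurable_entry k j).const_mul _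

theorem integrable_ev {μ : Measure (Matrix (Fin M) (Fin M) ℂ)} (hμ : IsHaarUnitary M μ)
    (p : UPoly M) : Integrable (fun U => ev U p) μ := by
  obtain ⟨K, hK⟩ := exists_bound_ev p
  have := hμ.1
  exact Integrable.of_bound (measurable_ev p).aestronglyMeasurable K
    (hμ.2.1.mono fun U hU => hK U hU)

section

open scoped Matrix.Norms.Operator

theorem exists_unitary_flow (A : Matrix (Fin M) (Fin M) ℂ) (hA : Aᴴ = -A) :
    ∃ V : ℝ → Matrix (Fin M) (Fin M) ℂ, V 0 = 1 ∧ (∀ t, V t ∈ Matrix.unitaryGroup (Fin M) ℂ) ∧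
      ∀ t i j, HasDerivAt (fun s => V s i j) ((A * V t) i j) t := by
  refine ⟨fun t => NormedSpace.exp (t • A), by simp, fun t => ?_, fun t i j => ?_⟩
  · rw [Matrix.mem_unitaryGroup_iff', Matrix.star_eq_conjTranspose, ← Matrix.exp_conjTranspose,
      Matrix.conjTranspose_smul, hA, star_trivial, smul_neg,
      ← Matrix.exp_add_of_commute _ _ (Commute.neg_left (Commute.refl (t • A)))]
    simp
  · have h := hasDerivAt_exp_smul_const' (𝕂 := ℝ) A t
    exact (LinearMap.toContinuousLinearMap
      (Matrix.entryLinearMap ℝ ℂ i j)).hasFDerivAt.comp_hasDerivAt t h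

end

theorem integral_lieD_of_skew {μ : Measure (Matrix (Fin M) (Fin M) ℂ)} (hμ : IsHaarUnitary M μ)
    (A : Matrix (Fin M) (Fin M) ℂ) (hA : Aᴴ = -A) (p : UPoly M) :
    ∫ U, ev U (lieD A p) ∂μ = 0 := by
  obtain ⟨V, hV0, hVu, hV⟩ := exists_unitary_flow A hA
  have := hμ.1
  obtain ⟨K, hK⟩ := exists_bound_ev (lieD A p)
  have hconst : ∀ t, ∫ U, ev (V t * U) p ∂μ = ∫ U, ev U p ∂μ := by
    intro t
    conv_rhs => rw [← hμ.2.2 (V t) (hVu t)]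
    rw [integral_map (measurable_mul_left _).aemeasurable (measurable_ev p).aestronglyMeasurable]
  have key := (hasDerivAt_integral_of_dominated_loc_of_deriv_le (μ := μ) (𝕜 := ℝ)
    (F := fun t U => ev (V t * U) p) (F' := fun t U => ev (V t * U) (lieD A p)) (x₀ := (0 : ℝ))
    (s := Set.univ) (bound := fun _ => K) Filter.univ_mem
    (Eventually.of_forall fun t =>
      ((measurable_ev p).comp (measurable_mul_left _)).aestronglyMeasurable)
    (by simpa [hV0] using integrable_ev hμ p)
    (((measurable_ev _).comp (measurable_mul_left _)).aestronglyMeasurable)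
    (hμ.2.1.mono fun U hU t _ => hK _ (mul_mem (hVu t) hU))
    (integrable_const K)
    (Eventually.of_forall fun U t _ => hasDerivAt_ev A hA (fun s => V s * U) t (fun i j => by
      rw [← Matrix.mul_assoc]
      simp only [Matrix.mul_apply (M := V _), Matrix.mul_apply (M := A * V t)]
      exact HasDerivAt.fun_sum fun k _ => (hV t i k).mul_const _) p)).2
  simp only [hconst, hV0, one_mul] at key
  exact key.unique (hasDerivAt_const _ _)

theorem integral_lieD {μ : Measure (Matrix (Fin M) (Fin M) ℂ)} (hμ : IsHaarUnitary M μ)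
    (A : Matrix (Fin M) (Fin M) ℂ) (p : UPoly M) :
    ∫ U, ev U (lieD A p) ∂μ = 0 := by
  have hdec : A = (2⁻¹ : ℂ) • (A - Aᴴ) + Complex.I • (-(Complex.I / 2) • (A + Aᴴ)) := by
    rw [smul_smul, show Complex.I * -(Complex.I / 2) = 2⁻¹ by
      linear_combination (-(1 / 2) : ℂ) * Complex.I_mul_I, ← smul_add]
    rw [show A - Aᴴ + (A + Aᴴ) = (2 : ℂ) • A by rw [two_smul]; abel, smul_smul]
    norm_num
  rw [hdec, lieD_add_smul]
  simp only [Derivation.add_apply, Derivation.smul_apply, map_add, map_smul]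
  rw [integral_add (integrable_ev hμ _) (Integrable.fun_smul _ (integrable_ev hμ _)), integral_smul,
    integral_lieD_of_skew hμ _ _ p, integral_lieD_of_skew hμ _ _ p, smul_zero, add_zero]
  · simp only [neg_smul, Matrix.conjTranspose_neg, Matrix.conjTranspose_smul,
      Matrix.conjTranspose_add, Matrix.conjTranspose_conjTranspose, star_div₀, Complex.star_def,
      Complex.conj_I, Complex.conj_ofNat, neg_div, neg_neg, add_comm]
  · simp [Matrix.conjTranspose_smul, Matrix.conjTranspose_sub, ← smul_neg]

/-- The derivation appearing in the Schwinger–Dyson equation for `U l j`. -/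
noncomputable def loopD (l j : Fin M) : Derivation ℂ (UPoly M) (UPoly M) :=
  mkDerivation ℂ fun v =>
    if v.2 then (if l = v.1.1 ∧ j = v.1.2 then 1 else 0)
    else -(X ((v.1.1, j), false) * X ((l, v.1.2), false))

theorem loopD_X_false (l j p q : Fin M) :
    loopD l j (X ((p, q), false)) = -(X ((p, j), false) * X ((l, q), false)) := by
  simp [loopD, mkDerivation_X]

theorem loopD_X_true (l j p q : Fin M) :
    loopD l j (X ((p, q), true)) = if l = p ∧ j = q then 1 else 0 := by
  simp [loopD, mkDerivation_X]

theorem ev_loopD {U : Matrix (Fin M) (Fin M) ℂ} (hU : U ∈ Matrix.unitaryGroup (Fin M) ℂ)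
    (l j : Fin M) (p : UPoly M) :
    ev U (loopD l j p) = -∑ k, U k j * ev U (lieD (Matrix.single k l 1) p) := by
  induction p using MvPolynomial.induction_on with
  | C a => simp [← MvPolynomial.algebraMap_eq]
  | add p q hp hq =>
    simp only [map_add, hp, hq, mul_add, Finset.sum_add_distrib, neg_add]
  | mul_X p v hp =>
    have hX : ev U (loopD l j (X v)) =
        -∑ k, U k j * ev U (lieD (Matrix.single k l 1) (X v)) := by
      obtain ⟨⟨r, s⟩, _ | _⟩ := v
      · simp only [loopD_X_false, lieD_X_false, map_sum, map_mul, map_neg, ev_X_false, ev_C]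
        congr 1
        simp [Matrix.single_apply, ite_and, Finset.sum_ite_eq]
      · simp only [loopD_X_true, lieD_X_true, map_sum, map_mul, map_neg, ev_X_true, ev_C]
        have h := congrFun (congrFun (Matrix.mem_unitaryGroup_iff'.1 hU) s) j
        rw [Matrix.mul_apply, Matrix.one_apply] at h
        simp only [Matrix.star_apply] at h
        by_cases hlr : l = r
        · subst hlr
          simp only [Matrix.single_apply, and_true, true_and]
          simp only [neg_mul, ite_mul, one_mul, zero_mul, Finset.sum_neg_distrib,
            Finset.sum_ite_eq, Finset.mem_univ, if_true, mul_neg, neg_neg]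
          rw [apply_ite (ev U), map_one, map_zero]
          simp only [mul_comm (U _ j), h, eq_comm]
        · simp [hlr]
    simp only [Derivation.leibniz, map_add, smul_eq_mul, map_mul, hp, hX, mul_add,
      Finset.sum_add_distrib, mul_neg, Finset.mul_sum, neg_add]
    congr 2 <;> exact Finset.sum_congr rfl fun k _ => by ring

/-- Expectation of a polynomial in the entries. -/
noncomputable def expect (μ : Measure (Matrix (Fin M) (Fin M) ℂ)) (p : UPoly M) : ℂ :=
  ∫ U, ev U p ∂μ

theorem expect_add {μ : Measure (Matrix (Fin M) (Fin M) ℂ)} (hμ : IsHaarUnitary M μ)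
    (p q : UPoly M) : expect μ (p + q) = expect μ p + expect μ q := by
  simp only [expect, map_add]
  exact integral_add (integrable_ev hμ p) (integrable_ev hμ q)

theorem expect_smul (μ : Measure (Matrix (Fin M) (Fin M) ℂ)) (c : ℂ) (p : UPoly M) :
    expect μ (c • p) = c * expect μ p := by
  simp only [expect, map_smul]
  exact integral_smul c _

theorem expect_one {μ : Measure (Matrix (Fin M) (Fin M) ℂ)} (hμ : IsHaarUnitary M μ) :
    expect μ 1 = 1 := by
  have := hμ.1
  simp [expect]

theorem norm_expect_le {μ : Measure (Matrix (Fin M) (Fin M) ℂ)} (hμ : IsHaarUnitary M μ)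
    (p : UPoly M) (K : ℝ) (hK : ∀ U ∈ Matrix.unitaryGroup (Fin M) ℂ, ‖ev U p‖ ≤ K) :
    ‖expect μ p‖ ≤ K := by
  have := hμ.1
  simpa [expect] using norm_integral_le_of_norm_le_const (hμ.2.1.mono fun U hU => hK U hU)

/-- The Schwinger–Dyson (loop) equation for Haar unitary matrices. -/
theorem expect_loop {μ : Measure (Matrix (Fin M) (Fin M) ℂ)} (hμ : IsHaarUnitary M μ)
    (l j : Fin M) (p : UPoly M) :
    (M : ℂ) * expect μ (X ((l, j), false) * p) = expect μ (loopD l j p) := by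
  have h1 : ∀ k : Fin M, expect μ (X ((l, j), false) * p) =
      -∫ U, U k j * ev U (lieD (Matrix.single k l 1) p) ∂μ := by
    intro k
    have h := integral_lieD hμ (Matrix.single k l 1) (X ((k, j), false) * p)
    have h2 : lieD (Matrix.single k l 1) (X ((k, j), false) * p) =
        X ((l, j), false) * p + X ((k, j), false) * lieD (Matrix.single k l 1) p := by
      rw [Derivation.leibniz, lieD_X_false]
      simp only [Matrix.single_apply, true_and, smul_eq_mul, apply_ite C, map_one, map_zero,
        ite_mul, one_mul, zero_mul, Finset.sum_ite_eq, Finset.mem_univ, if_true]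
      ring
    have h3 := expect_add hμ (X ((l, j), false) * p)
      (X ((k, j), false) * lieD (Matrix.single k l 1) p)
    rw [← h2] at h3
    rw [expect, h] at h3
    have h4 : expect μ (X ((k, j), false) * lieD (Matrix.single k l 1) p) =
        ∫ U, U k j * ev U (lieD (Matrix.single k l 1) p) ∂μ := by
      simp only [expect, map_mul, ev_X_false]
    rw [← h4]
    linear_combination -h3
  have h5 : expect μ (loopD l j p) =
      ∫ U, -∑ k, U k j * ev U (lieD (Matrix.single k l 1) p) ∂μ :=
    integral_congr_ae (hμ.2.1.mono fun U hU => ev_loopD hU l j p)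
  rw [h5, integral_neg, integral_finsetSum, ← Finset.sum_neg_distrib]
  · simp only [← h1]
    simp
  · intro k _
    have := integrable_ev hμ (X ((k, j), false) * lieD (Matrix.single k l 1) p)
    simpa only [map_mul, ev_X_false] using this

end HaarLoop

namespace HaarLoop

variable {α ν A : Type*} [Fintype α] [Fintype ν] [DecidableEq α] [DecidableEq ν] [CommRing A]

/-- The partial transpose of a matrix indexed by `α × ν`. -/
def pt {A : Type*} (u : Matrix (α × ν) (α × ν) A) : Matrix (α × ν) (α × ν) A :=
  Matrix.of fun i j => u (i.1, j.2) (j.1, i.2)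

/-- The alternating word `S W S W ⋯ S` with `k + 1` letters `S`. -/
def alt {m : Type*} [Fintype m] [DecidableEq m] (W S : Matrix m m A) (k : ℕ) : Matrix m m A :=
  (S * W) ^ k * S

theorem alt_succ {m : Type*} [Fintype m] [DecidableEq m] (W S : Matrix m m A) (k : ℕ) :
    alt W S (k + 1) = S * W * alt W S k := by
  rw [alt, alt, pow_succ', Matrix.mul_assoc (S * W)]

theorem mul_alt {m : Type*} [Fintype m] [DecidableEq m] (W S : Matrix m m A) (k : ℕ) :
    W * alt W S k = (W * S) ^ (k + 1) := by
  induction k with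
  | zero => simp [alt]
  | succ k ih => rw [alt_succ, pow_succ' (W * S), ← ih]; simp only [Matrix.mul_assoc]

theorem alt_mul {m : Type*} [Fintype m] [DecidableEq m] (W S : Matrix m m A) (k : ℕ) :
    alt W S k * W = (S * W) ^ (k + 1) := by
  rw [alt, pow_succ, Matrix.mul_assoc]

/-- Contraction of a letter with an alternating word along the `ν`-indices. -/
def contr (W S : Matrix (α × ν) (α × ν) A) (k : ℕ) (x y x' y' : α) : A :=
  ∑ β₁, ∑ β₂, W (x, β₁) (y, β₂) * alt W S k (x', β₂) (y', β₁)

/-- Partial trace over the `ν`-indices. -/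
def ptrace (Z : Matrix (α × ν) (α × ν) A) (x y : α) : A := ∑ β, Z (x, β) (y, β)

theorem ptrace_one (x y : α) :
    ptrace (1 : Matrix (α × ν) (α × ν) A) x y = if x = y then (Fintype.card ν : A) else 0 := by
  simp [ptrace, Matrix.one_apply]

theorem ptrace_pow_succ (W S : Matrix (α × ν) (α × ν) A) (k : ℕ) (x y : α) :
    ptrace ((S * W) ^ (k + 1)) x y = ∑ z, contr W S k z y x z := by
  simp only [ptrace, contr, ← alt_mul, Matrix.mul_apply, Fintype.sum_prod_type]
  rw [Finset.sum_comm]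
  refine Finset.sum_congr rfl fun z _ => ?_
  rw [Finset.sum_comm]
  exact Finset.sum_congr rfl fun _ _ => Finset.sum_congr rfl fun _ _ => mul_comm _ _

theorem ptrace_pow_succ' (W S : Matrix (α × ν) (α × ν) A) (k : ℕ) (x y : α) :
    ptrace ((W * S) ^ (k + 1)) x y = ∑ z, contr W S k x z z y := by
  simp only [ptrace, contr, ← mul_alt, Matrix.mul_apply, Fintype.sum_prod_type]
  rw [Finset.sum_comm]

variable [Algebra ℂ A]

theorem map_derivation_mul {m : Type*} [Fintype m] (d : Derivation ℂ A A) (X Y : Matrix m m A) :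
    (X * Y).map d = X.map d * Y + X * Y.map d := by
  ext i j
  simp only [Matrix.map_apply, Matrix.add_apply, Matrix.mul_apply, map_sum, Derivation.leibniz,
    smul_eq_mul, Finset.sum_add_distrib]
  rw [add_comm]
  congr 1
  exact Finset.sum_congr rfl fun k _ => mul_comm _ _

theorem map_derivation_alt {m : Type*} [Fintype m] [DecidableEq m] (d : Derivation ℂ A A)
    (W S : Matrix m m A) (k : ℕ) :
    (alt W S k).map d = ∑ j ∈ Finset.range (k + 1), (S * W) ^ j * S.map d * (W * S) ^ (k - j) +
      ∑ j ∈ Finset.range k, alt W S j * W.map d * alt W S (k - (j + 1)) := by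
  induction k with
  | zero => simp [alt]
  | succ k ih =>
    rw [Finset.sum_range_succ' _ (k + 1), Finset.sum_range_succ' (fun j => alt W S j * _ * _) k, alt_succ, map_derivation_mul,
      map_derivation_mul, ih]
    simp only [Matrix.mul_add, Matrix.add_mul, Finset.mul_sum]
    have e1 : S.map d * W * alt W S k = S.map d * (W * S) ^ (k + 1) := by
      rw [Matrix.mul_assoc, mul_alt]
    have e2 : alt W S 0 = S := by simp [alt]
    have e3 : ∀ j, S * W * (alt W S j * W.map d * alt W S (k - (j + 1))) =
        alt W S (j + 1) * W.map d * alt W S (k + 1 - (j + 1 + 1)) := by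
      intro j
      rw [alt_succ, Nat.add_sub_add_right]
      simp only [Matrix.mul_assoc]
    have e4 : ∀ j, S * W * ((S * W) ^ j * S.map d * (W * S) ^ (k - j)) =
        (S * W) ^ (j + 1) * S.map d * (W * S) ^ (k + 1 - (j + 1)) := by
      intro j
      rw [pow_succ', Nat.add_sub_add_right]
      simp only [Matrix.mul_assoc]
    simp only [e1, e2, e3, e4, pow_zero, one_mul, Nat.sub_zero, zero_add, Nat.add_sub_cancel]
    abel

/-- The derivation rules for the loop equation at the pair of indices `l`, `j`. -/
structure IsLoop (d : Derivation ℂ A A) (u us : Matrix (α × ν) (α × ν) A) (l j : α × ν) : Prop where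
  on_u : ∀ p q, d (u p q) = -(u p j * u l q)
  on_us : ∀ p q, d (us p q) = if p = j ∧ q = l then 1 else 0

variable {u us : Matrix (α × ν) (α × ν) A} {d : Derivation ℂ A A}

theorem IsLoop.map_pt {x y : α} {β₁ β₂ : ν} (h : IsLoop d u us (x, β₂) (y, β₁)) :
    (pt u).map d = Matrix.of fun p q => -(pt u (p.1, β₁) (y, q.2) * pt u (x, p.2) (q.1, β₂)) := by
  ext p q
  simp [pt, h.on_u]

theorem IsLoop.map_pt_star {x y : α} {β₁ β₂ : ν} (h : IsLoop d u us (x, β₂) (y, β₁)) :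
    (pt us).map d = Matrix.single (y, β₂) (x, β₁) 1 := by
  ext ⟨p, p'⟩ ⟨q, q'⟩
  simp only [pt, Matrix.map_apply, Matrix.of_apply, h.on_us, Matrix.single_apply, Prod.mk.injEq]
  congr 1
  apply propext
  constructor <;> (rintro ⟨⟨rfl, rfl⟩, ⟨rfl, rfl⟩⟩; simp)

theorem sum_loop_alt (d : α × ν → α × ν → Derivation ℂ A A) (hd : ∀ l j, IsLoop (d l j) u us l j)
    (k : ℕ) (x y x' y' : α) :
    ∑ β₁, ∑ β₂, d (x, β₂) (y, β₁) (alt (pt u) (pt us) k (x', β₂) (y', β₁)) =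
      ∑ j ∈ Finset.range (k + 1), ptrace ((pt us * pt u) ^ j) x' y *
        ptrace ((pt u * pt us) ^ (k - j)) x y' -
      ∑ j ∈ Finset.range k, ∑ z, ∑ z', contr (pt u) (pt us) (k - (j + 1)) z y z' y' *
        contr (pt u) (pt us) j x z' x' z := by
  have key : ∀ β₁ β₂, d (x, β₂) (y, β₁) (alt (pt u) (pt us) k (x', β₂) (y', β₁)) =
      ∑ j ∈ Finset.range (k + 1), ((pt us * pt u) ^ j) (x', β₂) (y, β₂) *
        ((pt u * pt us) ^ (k - j)) (x, β₁) (y', β₁) -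
      ∑ j ∈ Finset.range k, ∑ q : α × ν, ∑ p : α × ν, alt (pt u) (pt us) j (x', β₂) p *
        (pt u (p.1, β₁) (y, q.2) * pt u (x, p.2) (q.1, β₂)) *
        alt (pt u) (pt us) (k - (j + 1)) q (y', β₁) := by
    intro β₁ β₂
    have h := congrFun (congrFun (map_derivation_alt (d (x, β₂) (y, β₁)) (pt u) (pt us) k)
      (x', β₂)) (y', β₁)
    rw [Matrix.map_apply] at h
    rw [h, (hd _ _).map_pt, (hd _ _).map_pt_star, Matrix.add_apply, Matrix.sum_apply,
      Matrix.sum_apply, sub_eq_add_neg, ← Finset.sum_neg_distrib]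
    congr 1
    · refine Finset.sum_congr rfl fun j _ => ?_
      rw [Matrix.mul_apply, Finset.sum_eq_single (x, β₁)]
      · rw [Matrix.mul_single_apply_same, mul_one]
      · intro q _ hq
        rw [Matrix.mul_single_apply_of_ne _ _ _ _ _ hq, zero_mul]
      · simp
    · refine Finset.sum_congr rfl fun j _ => ?_
      simp only [Matrix.mul_apply (N := alt _ _ _), Matrix.mul_apply (M := alt _ _ _),
        Matrix.of_apply, Finset.sum_mul, mul_neg, neg_mul, Finset.sum_neg_distrib]
  simp only [key, Finset.sum_sub_distrib]
  congr 1
  · simp only [ptrace, Finset.sum_mul_sum]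
    rw [Finset.sum_comm' (t' := Finset.univ) (s' := fun _ => Finset.univ) (by simp)]
    simp only [Finset.sum_comm (s := Finset.univ) (t := Finset.range (k + 1))]
  · simp only [Finset.sum_comm (s := Finset.univ) (t := Finset.range k)]
    refine Finset.sum_congr rfl fun j _ => ?_
    let f : ν × ν × α × ν × α × ν → A := fun t =>
      alt (pt u) (pt us) j (x', t.2.1) (t.2.2.2.2.1, t.2.2.2.2.2) *
        (pt u (t.2.2.2.2.1, t.1) (y, t.2.2.2.1) * pt u (x, t.2.2.2.2.2) (t.2.2.1, t.2.1)) *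
        alt (pt u) (pt us) (k - (j + 1)) (t.2.2.1, t.2.2.2.1) (y', t.1)
    let g : α × α × ν × ν × ν × ν → A := fun t =>
      (pt u (t.1, t.2.2.2.2.1) (y, t.2.2.2.2.2) *
        alt (pt u) (pt us) (k - (j + 1)) (t.2.1, t.2.2.2.2.2) (y', t.2.2.2.2.1)) *
      (pt u (x, t.2.2.1) (t.2.1, t.2.2.2.1) *
        alt (pt u) (pt us) j (x', t.2.2.2.1) (t.1, t.2.2.1))
    let e : ν × ν × α × ν × α × ν ≃ α × α × ν × ν × ν × ν :=
      { toFun := fun t => (t.2.2.2.2.1, t.2.2.1, t.2.2.2.2.2, t.2.1, t.1, t.2.2.2.1)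
        invFun := fun t => (t.2.2.2.2.1, t.2.2.2.1, t.2.1, t.2.2.2.2.2, t.1, t.2.2.1)
        left_inv := fun _ => rfl
        right_inv := fun _ => rfl }
    have h := Fintype.sum_equiv e f g fun t => by simp only [f, g, e, Equiv.coe_fn_mk]; ring
    simp only [Fintype.sum_prod_type, f, g] at h
    simp only [Fintype.sum_prod_type, contr, Finset.sum_mul, Finset.mul_sum] at h ⊢
    exact h

end HaarLoop

namespace HaarLoop

section Bounds

open scoped Matrix.Norms.Frobenius

variable {m α ν : Type*} [Fintype m] [DecidableEq m] [Fintype α] [Fintype ν] [DecidableEq α]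
  [DecidableEq ν]

theorem frobenius_norm_sq (Z : Matrix m m ℂ) : ‖Z‖ ^ 2 = ∑ i, ∑ j, ‖Z i j‖ ^ 2 := by
  rw [Matrix.frobenius_norm_def, ← Real.sqrt_eq_rpow, Real.sq_sqrt]
  · simp
  · positivity

theorem frobenius_norm_one_sq : ‖(1 : Matrix m m ℂ)‖ ^ 2 = Fintype.card m := by
  rw [frobenius_norm_sq]
  simp [Matrix.one_apply, apply_ite]

theorem norm_entry_le (Z : Matrix m m ℂ) (i j : m) : ‖Z i j‖ ≤ ‖Z‖ := by
  refine le_of_sq_le_sq ?_ (norm_nonneg _)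
  rw [frobenius_norm_sq]
  exact (Finset.single_le_sum (f := fun j => ‖Z i j‖ ^ 2) (fun _ _ => by positivity)
    (Finset.mem_univ j)).trans
    (Finset.single_le_sum (f := fun i => ∑ j, ‖Z i j‖ ^ 2) (fun _ _ => by positivity)
    (Finset.mem_univ i))

theorem sum_norm_sq_vecMul {U : Matrix m m ℂ} (hU : U ∈ Matrix.unitaryGroup m ℂ) (v : m → ℂ) :
    ∑ j, ‖∑ i, v i * U i j‖ ^ 2 = ∑ i, ‖v i‖ ^ 2 := by
  have key : ∀ w : m → ℂ, ((∑ j, ‖w j‖ ^ 2 : ℝ) : ℂ) = w ⬝ᵥ star w := by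
    intro w
    simp [dotProduct, ← Complex.mul_conj']
  have h : (v ᵥ* U) ⬝ᵥ star (v ᵥ* U) = v ⬝ᵥ star v := by
    rw [Matrix.star_vecMul, ← Matrix.dotProduct_mulVec, Matrix.mulVec_mulVec]
    have := Matrix.mem_unitaryGroup_iff.1 hU
    rw [Matrix.star_eq_conjTranspose] at this
    rw [this, Matrix.one_mulVec]
  rw [← key, ← key] at h
  exact_mod_cast h

theorem conjTranspose_mem_unitary {U : Matrix m m ℂ} (hU : U ∈ Matrix.unitaryGroup m ℂ) :
    Uᴴ ∈ Matrix.unitaryGroup m ℂ := by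
  rw [← Matrix.star_eq_conjTranspose]
  exact Unitary.star_mem hU

theorem sum_norm_sq_row {U : Matrix m m ℂ} (hU : U ∈ Matrix.unitaryGroup m ℂ) (i : m) :
    ∑ j, ‖U i j‖ ^ 2 = 1 := by
  have := sum_norm_sq_vecMul hU (Pi.single i 1)
  simpa [Pi.single_apply, apply_ite] using this

theorem sum_norm_sq_col {U : Matrix m m ℂ} (hU : U ∈ Matrix.unitaryGroup m ℂ) (j : m) :
    ∑ i, ‖U i j‖ ^ 2 = 1 := by
  simpa using sum_norm_sq_row (conjTranspose_mem_unitary hU) j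

theorem pt_conjTranspose (U : Matrix (α × ν) (α × ν) ℂ) : pt Uᴴ = (pt U)ᴴ := by
  ext i j
  simp [pt]

theorem norm_pt_mul_le {U : Matrix (α × ν) (α × ν) ℂ}
    (hU : U ∈ Matrix.unitaryGroup (α × ν) ℂ) (B : Matrix (α × ν) (α × ν) ℂ) :
    ‖pt U * B‖ ≤ Fintype.card α * ‖B‖ := by
  refine le_of_sq_le_sq ?_ (by positivity)
  rw [mul_pow, frobenius_norm_sq, frobenius_norm_sq]
  have hblock : ∀ (a a' : α) (c : α × ν),
      ∑ β, ‖∑ β', U (a, β') (a', β) * B (a', β') c‖ ^ 2 ≤ ∑ β', ‖B (a', β') c‖ ^ 2 := by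
    intro a a' c
    have h := sum_norm_sq_vecMul hU fun i => if i.1 = a then B (a', i.2) c else 0
    simp only [Fintype.sum_prod_type, ite_mul, zero_mul, apply_ite norm, norm_zero, ite_pow] at h
    simp only [Finset.sum_comm (s := (Finset.univ : Finset α)) (t := (Finset.univ : Finset ν)),
      Finset.sum_ite_eq', Finset.mem_univ, if_true] at h
    rw [Finset.sum_comm] at h
    simp only [ne_eq, OfNat.ofNat_ne_zero, not_false_eq_true, zero_pow, Finset.sum_ite_eq',
      Finset.mem_univ, if_true] at h
    rw [← h]
    refine le_trans (le_of_eq ?_) (Finset.single_le_sum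
      (f := fun x => ∑ y, ‖∑ z, B (a', z) c * U (a, z) (x, y)‖ ^ 2)
      (fun _ _ => by positivity) (Finset.mem_univ a'))
    simp only [mul_comm]
  have hentry : ∀ (a : α) (β : ν) (c : α × ν), ‖(pt U * B) (a, β) c‖ ^ 2 ≤
      Fintype.card α * ∑ a', ‖∑ β', U (a, β') (a', β) * B (a', β') c‖ ^ 2 := by
    intro a β c
    rw [Matrix.mul_apply, Fintype.sum_prod_type]
    refine le_trans (pow_le_pow_left₀ (norm_nonneg _) (norm_sum_le _ _) 2) ?_
    have := sq_sum_le_card_mul_sum_sq (s := Finset.univ)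
      (f := fun a' => ‖∑ β', U (a, β') (a', β) * B (a', β') c‖)
    rw [Finset.card_univ] at this
    exact this
  calc ∑ i, ∑ j, ‖(pt U * B) i j‖ ^ 2
      = ∑ j, ∑ a, ∑ β, ‖(pt U * B) (a, β) j‖ ^ 2 := by
        rw [Finset.sum_comm]; simp only [Fintype.sum_prod_type (f := fun i => ‖(pt U * B) i _‖ ^ 2)]
    _ ≤ ∑ j, ∑ a, ∑ β, Fintype.card α *
          ∑ a', ‖∑ β', U (a, β') (a', β) * B (a', β') j‖ ^ 2 := by
        gcongr with j _ a _ β _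
        exact hentry a β j
    _ = ∑ j, ∑ _a : α, Fintype.card α * ∑ a', ∑ β,
          ‖∑ β', U (_a, β') (a', β) * B (a', β') j‖ ^ 2 := by
        refine Finset.sum_congr rfl fun j _ => Finset.sum_congr rfl fun a _ => ?_
        rw [← Finset.mul_sum, Finset.sum_comm]
    _ ≤ ∑ j, ∑ _a : α, Fintype.card α * ∑ a', ∑ β', ‖B (a', β') j‖ ^ 2 := by
        exact Finset.sum_le_sum fun j _ => Finset.sum_le_sum fun a _ =>
          mul_le_mul_of_nonneg_left (Finset.sum_le_sum fun a' _ => hblock a a' j) (by positivity)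
    _ = Fintype.card α ^ 2 * ∑ i, ∑ j, ‖B i j‖ ^ 2 := by
        rw [Finset.sum_comm (s := (Finset.univ : Finset (α × ν))) (f := fun i j => ‖B i j‖ ^ 2),
          Finset.mul_sum]
        refine Finset.sum_congr rfl fun j _ => ?_
        rw [Finset.sum_const, Finset.card_univ, nsmul_eq_mul, Fintype.sum_prod_type]
        ring

/-- Multiplication by `Z` on either side is bounded by `c` in Frobenius norm. -/
def OpBound (c : ℝ) (Z : Matrix m m ℂ) : Prop :=
  ∀ B : Matrix m m ℂ, ‖Z * B‖ ≤ c * ‖B‖ ∧ ‖B * Z‖ ≤ c * ‖B‖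

theorem OpBound.mul {c c' : ℝ} {Z Z' : Matrix m m ℂ} (hc : 0 ≤ c) (hc' : 0 ≤ c')
    (h : OpBound c Z) (h' : OpBound c' Z') :
    OpBound (c * c') (Z * Z') := by
  intro B
  constructor
  · calc ‖Z * Z' * B‖ = ‖Z * (Z' * B)‖ := by rw [Matrix.mul_assoc]
      _ ≤ c * (c' * ‖B‖) := ((h _).1).trans (mul_le_mul_of_nonneg_left (h' B).1 hc)
      _ = c * c' * ‖B‖ := by ring
  · calc ‖B * (Z * Z')‖ = ‖B * Z * Z'‖ := by rw [Matrix.mul_assoc]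
      _ ≤ c' * (c * ‖B‖) := ((h' _).2).trans (mul_le_mul_of_nonneg_left (h B).2 hc')
      _ = c * c' * ‖B‖ := by ring

theorem OpBound.pow {c : ℝ} {Z : Matrix m m ℂ} (hc : 0 ≤ c) (h : OpBound c Z) (k : ℕ) :
    OpBound (c ^ k) (Z ^ k) := by
  induction k with
  | zero => intro B; simp
  | succ k ih => rw [pow_succ, pow_succ]; exact ih.mul (by positivity) hc h

theorem OpBound.norm_le {c : ℝ} {Z : Matrix m m ℂ} (h : OpBound c Z) :
    ‖Z‖ ≤ c * ‖(1 : Matrix m m ℂ)‖ := by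
  simpa using (h 1).1

theorem OpBound.norm_entry_le {c : ℝ} {Z : Matrix m m ℂ} (h : OpBound c Z) (i j : m) :
    ‖Z i j‖ ≤ c := by
  have h1 := HaarLoop.norm_entry_le (Z * Matrix.single j j 1) i j
  rw [Matrix.mul_single_apply_same, mul_one] at h1
  have h2 := (h (Matrix.single j j 1)).1
  have h3 : ‖(Matrix.single j j 1 : Matrix m m ℂ)‖ = 1 := by
    have : ‖(Matrix.single j j 1 : Matrix m m ℂ)‖ ^ 2 = 1 := by
      rw [frobenius_norm_sq]
      simp [Matrix.single_apply, apply_ite, ite_and]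
    exact (pow_eq_one_iff_of_nonneg (norm_nonneg _) two_ne_zero).1 this
  rw [h3, mul_one] at h2
  exact h1.trans h2

theorem OpBound.alt {c : ℝ} {W S : Matrix m m ℂ} (hc : 0 ≤ c) (hW : OpBound c W)
    (hS : OpBound c S) (k : ℕ) : OpBound (c ^ (2 * k + 1)) (alt W S k) := by
  have := ((hS.mul hc hc hW).pow (mul_nonneg hc hc) k).mul (by positivity) hc hS
  rwa [← sq, ← pow_mul, ← pow_succ] at this

theorem opBound_pt {U : Matrix (α × ν) (α × ν) ℂ} (hU : U ∈ Matrix.unitaryGroup (α × ν) ℂ) :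
    OpBound (Fintype.card α : ℝ) (pt U) := by
  intro B
  refine ⟨norm_pt_mul_le hU B, ?_⟩
  have h := norm_pt_mul_le (conjTranspose_mem_unitary hU) Bᴴ
  rwa [pt_conjTranspose, ← Matrix.conjTranspose_mul, Matrix.frobenius_norm_conjTranspose,
    Matrix.frobenius_norm_conjTranspose] at h

theorem norm_pairing_le (Y Z : Matrix (α × ν) (α × ν) ℂ) (x y x' y' : α) :
    ‖∑ β₁, ∑ β₂, Y (x, β₁) (y, β₂) * Z (x', β₂) (y', β₁)‖ ≤ ‖Y‖ * ‖Z‖ := by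
  have hsub : ∀ (Z : Matrix (α × ν) (α × ν) ℂ) (x y : α),
      ∑ β₁, ∑ β₂, ‖Z (x, β₁) (y, β₂)‖ ^ 2 ≤ ‖Z‖ ^ 2 := by
    intro Z x y
    rw [frobenius_norm_sq]
    simp only [Fintype.sum_prod_type]
    refine le_trans ?_ (Finset.single_le_sum
      (f := fun x => ∑ β₁, ∑ y, ∑ β₂, ‖Z (x, β₁) (y, β₂)‖ ^ 2)
      (fun _ _ => by positivity) (Finset.mem_univ x))
    refine Finset.sum_le_sum fun β₁ _ => ?_
    exact Finset.single_le_sum (f := fun y => ∑ β₂, ‖Z (x, β₁) (y, β₂)‖ ^ 2)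
      (fun _ _ => by positivity) (Finset.mem_univ y)
  rw [← Fintype.sum_prod_type' (f := fun β₁ β₂ => Y (x, β₁) (y, β₂) * Z (x', β₂) (y', β₁))]
  refine (norm_sum_le _ _).trans ?_
  simp only [norm_mul]
  refine (Real.sum_mul_le_sqrt_mul_sqrt _ _ _).trans ?_
  refine mul_le_mul (Real.sqrt_le_iff.2 ⟨norm_nonneg _, ?_⟩)
    (Real.sqrt_le_iff.2 ⟨norm_nonneg _, ?_⟩) (Real.sqrt_nonneg _) (norm_nonneg _)
  · rw [Fintype.sum_prod_type]
    exact hsub Y x y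
  · rw [Fintype.sum_prod_type, Finset.sum_comm]
    exact hsub Z x' y'

theorem norm_contr_le {c : ℝ} {W S : Matrix (α × ν) (α × ν) ℂ} (hc : 0 ≤ c) (hW : OpBound c W)
    (hS : OpBound c S) (k : ℕ) (x y x' y' : α) :
    ‖contr W S k x y x' y'‖ ≤
      c ^ (2 * k + 2) * ((Fintype.card α : ℝ) * Fintype.card ν) := by
  refine (norm_pairing_le _ _ _ _ _ _).trans ?_
  refine (mul_le_mul hW.norm_le (hW.alt hc hS k).norm_le (norm_nonneg _) (by positivity)).trans ?_
  have h := frobenius_norm_one_sq (m := α × ν)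
  rw [Fintype.card_prod, Nat.cast_mul] at h
  rw [← h]
  apply le_of_eq
  ring

theorem norm_deriv_alt_le {c : ℝ} {W S dW dS : Matrix m m ℂ} (hc : 0 ≤ c) (hW : OpBound c W)
    (hS : OpBound c S) (hdW : ‖dW‖ ≤ 1) (hdS : ‖dS‖ ≤ 1) (k : ℕ) :
    ‖∑ j ∈ Finset.range (k + 1), (S * W) ^ j * dS * (W * S) ^ (k - j) +
      ∑ j ∈ Finset.range k, alt W S j * dW * alt W S (k - (j + 1))‖ ≤
      (2 * k + 1) * c ^ (2 * k) := by
  have hcc := mul_nonneg hc hc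
  refine (norm_add_le _ _).trans ?_
  have h1 : ‖∑ j ∈ Finset.range (k + 1), (S * W) ^ j * dS * (W * S) ^ (k - j)‖ ≤
      (k + 1) * c ^ (2 * k) := by
    refine (norm_sum_le_of_le (f := fun j => (S * W) ^ j * dS * (W * S) ^ (k - j)) _
      (n := fun _ => c ^ (2 * k)) fun j hj => ?_).trans (by simp)
    have hj := Finset.mem_range.1 hj
    refine (((hW.mul hc hc hS).pow hcc (k - j) _).2).trans ?_
    have h3 := ((hS.mul hc hc hW).pow hcc j dS).1
    calc (c * c) ^ (k - j) * ‖(S * W) ^ j * dS‖ ≤ (c * c) ^ (k - j) * ((c * c) ^ j * 1) := by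
          gcongr
          exact h3.trans (by gcongr)
      _ = c ^ (2 * k) := by
          rw [mul_one, ← pow_add, show k - j + j = k by omega, ← sq, pow_mul]
  have h2 : ‖∑ j ∈ Finset.range k, alt W S j * dW * alt W S (k - (j + 1))‖ ≤
      k * c ^ (2 * k) := by
    refine (norm_sum_le_of_le (f := fun j => alt W S j * dW * alt W S (k - (j + 1))) _
      (n := fun _ => c ^ (2 * k)) fun j hj => ?_).trans (by simp)
    have hj := Finset.mem_range.1 hj
    refine (((hW.alt hc hS (k - (j + 1))) _).2).trans ?_
    have h3 := ((hW.alt hc hS j) dW).1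
    calc c ^ (2 * (k - (j + 1)) + 1) * ‖alt W S j * dW‖ ≤
          c ^ (2 * (k - (j + 1)) + 1) * (c ^ (2 * j + 1) * 1) := by
          gcongr
          exact h3.trans (by gcongr)
      _ = c ^ (2 * k) := by
          rw [mul_one, ← pow_add]
          congr 1
          omega
  linarith

theorem norm_deriv_pt_le {U : Matrix (α × ν) (α × ν) ℂ} (hU : U ∈ Matrix.unitaryGroup (α × ν) ℂ)
    (x y : α) (β₁ β₂ : ν) :
    ‖(Matrix.of fun p q : α × ν =>
      -(pt U (p.1, β₁) (y, q.2) * pt U (x, p.2) (q.1, β₂)) : Matrix _ _ ℂ)‖ ≤ 1 := by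
  refine le_of_sq_le_sq ?_ zero_le_one
  rw [frobenius_norm_sq]
  have h : (∑ i, ‖U i (y, β₁)‖ ^ 2) * ∑ j, ‖U (x, β₂) j‖ ^ 2 = 1 := by
    rw [sum_norm_sq_col hU, sum_norm_sq_row hU, mul_one]
  rw [one_pow, ← h]
  apply le_of_eq
  simp only [pt, Matrix.of_apply, norm_neg, norm_mul, mul_pow, Finset.sum_mul_sum]
  simp only [← Fintype.sum_prod_type']
  exact Fintype.sum_equiv
    { toFun := fun t => ((t.1.1, t.2.2), (t.2.1, t.1.2))
      invFun := fun t => ((t.1.1, t.2.2), (t.2.1, t.1.2))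
      left_inv := fun _ => rfl
      right_inv := fun _ => rfl } _ _ fun _ => rfl

theorem map_alt {A : Type*} [CommRing A] [Algebra ℂ A] (f : A →ₐ[ℂ] ℂ)
    (u us : Matrix (α × ν) (α × ν) A) (k : ℕ) :
    (alt (pt u) (pt us) k).map f = alt (pt (u.map f)) (pt (us.map f)) k := by
  rw [← AlgHom.mapMatrix_apply, alt, map_mul, map_pow, map_mul]
  rfl

theorem norm_deriv_contr_le {A : Type*} [CommRing A] [Algebra ℂ A] (f : A →ₐ[ℂ] ℂ)
    {u us : Matrix (α × ν) (α × ν) A} (hU : u.map f ∈ Matrix.unitaryGroup (α × ν) ℂ)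
    (hs : us.map f = (u.map f)ᴴ) (d : α × ν → α × ν → Derivation ℂ A A)
    (hd : ∀ l j, IsLoop (d l j) u us l j) (x y : α) (β₁ β₂ : ν) (k : ℕ) (z w z' w' : α) :
    ‖f (d (x, β₂) (y, β₁) (contr (pt u) (pt us) k z w z' w'))‖ ≤
      (2 * k + 2) * (Fintype.card α : ℝ) ^ (2 * k + 1) *
        √((Fintype.card α : ℝ) * Fintype.card ν) := by
  set c : ℝ := ((Fintype.card α : ℕ) : ℝ) with hc
  have hc0 : 0 ≤ c := Nat.cast_nonneg _
  set W := pt (u.map f) with hW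
  set S := pt (us.map f) with hS
  have hWB : OpBound c W := opBound_pt hU
  have hSB : OpBound c S := opBound_pt (hs ▸ conjTranspose_mem_unitary hU)
  have hWf : (pt u).map f = W := rfl
  have hSf : (pt us).map f = S := rfl
  have haltf : ∀ k, (alt (pt u) (pt us) k).map f = alt W S k := map_alt f u us
  set dW : Matrix (α × ν) (α × ν) ℂ := ((pt u).map (d (x, β₂) (y, β₁))).map f with hdW
  set dS : Matrix (α × ν) (α × ν) ℂ := ((pt us).map (d (x, β₂) (y, β₁))).map f with hdS
  have hdWn : ‖dW‖ ≤ 1 := by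
    refine le_trans (le_of_eq ?_) (norm_deriv_pt_le hU x y β₁ β₂)
    congr 1
    rw [hdW, (hd _ _).map_pt]
    ext p q
    simp [pt]
  have hdSn : ‖dS‖ ≤ 1 := by
    rw [hdS, (hd _ _).map_pt_star]
    refine le_of_sq_le_sq ?_ zero_le_one
    rw [frobenius_norm_sq]
    simp [Matrix.single_apply, apply_ite, ite_and]
  have hdalt : ((alt (pt u) (pt us) k).map (d (x, β₂) (y, β₁))).map f =
      ∑ j ∈ Finset.range (k + 1), (S * W) ^ j * dS * (W * S) ^ (k - j) +
      ∑ j ∈ Finset.range k, alt W S j * dW * alt W S (k - (j + 1)) := by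
    rw [map_derivation_alt]
    have := map_add f.mapMatrix
      (∑ j ∈ Finset.range (k + 1), (pt us * pt u) ^ j * (pt us).map (d (x, β₂) (y, β₁)) *
        (pt u * pt us) ^ (k - j))
      (∑ j ∈ Finset.range k, alt (pt u) (pt us) j * (pt u).map (d (x, β₂) (y, β₁)) *
        alt (pt u) (pt us) (k - (j + 1)))
    simp only [map_sum, map_mul, map_pow] at this
    simp only [AlgHom.mapMatrix_apply, hWf, hSf, haltf] at this
    exact this
  set Z := ((alt (pt u) (pt us) k).map (d (x, β₂) (y, β₁))).map f with hZ
  have hZn : ‖Z‖ ≤ (2 * k + 1) * c ^ (2 * k) := by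
    rw [hdalt]
    exact norm_deriv_alt_le hc0 hWB hSB hdWn hdSn k
  have hone : ‖(1 : Matrix (α × ν) (α × ν) ℂ)‖ = √(c * Fintype.card ν) := by
    rw [eq_comm, Real.sqrt_eq_iff_eq_sq (by positivity) (norm_nonneg _), frobenius_norm_one_sq,
      Fintype.card_prod, Nat.cast_mul]
  have hexp : f (d (x, β₂) (y, β₁) (contr (pt u) (pt us) k z w z' w')) =
      (∑ δ₁, ∑ δ₂, W (z, δ₁) (w, δ₂) * Z (z', δ₂) (w', δ₁)) +
      ∑ δ₁, ∑ δ₂, dW (z, δ₁) (w, δ₂) * alt W S k (z', δ₂) (w', δ₁) := by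
    simp only [contr, map_sum, Derivation.leibniz, map_add, smul_eq_mul, map_mul,
      Finset.sum_add_distrib]
    congr 1
    simp only [← haltf]
    exact Finset.sum_congr rfl fun _ _ => Finset.sum_congr rfl fun _ _ => mul_comm _ _
  rw [hexp, ← hone]
  refine (norm_add_le _ _).trans ?_
  have h1 := (norm_pairing_le W Z z w z' w').trans
    (mul_le_mul hWB.norm_le hZn (norm_nonneg _) (by positivity))
  have h2 := (norm_pairing_le dW (alt W S k) z w z' w').trans
    (mul_le_mul hdWn (hWB.alt hc0 hSB k).norm_le (norm_nonneg _) zero_le_one)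
  refine (add_le_add h1 h2).trans (le_of_eq ?_)
  ring

theorem norm_map_contr_le {A : Type*} [CommRing A] [Algebra ℂ A] (f : A →ₐ[ℂ] ℂ)
    {u us : Matrix (α × ν) (α × ν) A} (hU : u.map f ∈ Matrix.unitaryGroup (α × ν) ℂ)
    (hs : us.map f = (u.map f)ᴴ) (k : ℕ) (z w z' w' : α) :
    ‖f (contr (pt u) (pt us) k z w z' w')‖ ≤
      (Fintype.card α : ℝ) ^ (2 * k + 2) * ((Fintype.card α : ℝ) * Fintype.card ν) := by
  have h := norm_contr_le (Nat.cast_nonneg _) (opBound_pt hU)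
    (opBound_pt (hs ▸ conjTranspose_mem_unitary hU : us.map f ∈ _)) k z w z' w'
  refine le_trans (le_of_eq ?_) h
  simp only [contr, map_sum, map_mul, ← map_alt]
  rfl

theorem norm_map_alt_le {A : Type*} [CommRing A] [Algebra ℂ A] (f : A →ₐ[ℂ] ℂ)
    {u us : Matrix (α × ν) (α × ν) A} (hU : u.map f ∈ Matrix.unitaryGroup (α × ν) ℂ)
    (hs : us.map f = (u.map f)ᴴ) (k : ℕ) (p q : α × ν) :
    ‖f (alt (pt u) (pt us) k p q)‖ ≤ (Fintype.card α : ℝ) ^ (2 * k + 1) := by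
  have h := ((opBound_pt hU).alt (Nat.cast_nonneg _)
    (opBound_pt (hs ▸ conjTranspose_mem_unitary hU : us.map f ∈ _)) k).norm_entry_le p q
  rwa [← map_alt] at h

end Bounds

end HaarLoop

namespace HaarLoop

variable {b N : ℕ}

/-- Generic unitary matrix with rows and columns indexed by `Fin b × Fin N`. -/
noncomputable def uMat (b N : ℕ) : Matrix (Fin b × Fin N) (Fin b × Fin N) (UPoly (b * N)) :=
  Matrix.of fun i j => MvPolynomial.X ((finProdFinEquiv i, finProdFinEquiv j), false)

/-- Conjugate transpose of `uMat`. -/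
noncomputable def usMat (b N : ℕ) : Matrix (Fin b × Fin N) (Fin b × Fin N) (UPoly (b * N)) :=
  Matrix.of fun i j => MvPolynomial.X ((finProdFinEquiv j, finProdFinEquiv i), true)

/-- The loop derivations, indexed by `Fin b × Fin N`. -/
noncomputable def blockD (l j : Fin b × Fin N) : Derivation ℂ (UPoly (b * N)) (UPoly (b * N)) :=
  loopD (finProdFinEquiv l) (finProdFinEquiv j)

theorem isLoop_blockD (l j : Fin b × Fin N) :
    IsLoop (blockD l j) (uMat b N) (usMat b N) l j where
  on_u p q := by simp only [uMat, Matrix.of_apply, blockD, loopD_X_false]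
  on_us p q := by
    simp only [usMat, Matrix.of_apply, blockD, loopD_X_true, EmbeddingLike.apply_eq_iff_eq]
    congr 1
    apply propext
    constructor <;> (rintro ⟨rfl, rfl⟩; simp)

theorem uMat_map_ev (U : Matrix (Fin (b * N)) (Fin (b * N)) ℂ) :
    (uMat b N).map (ev U) = U.submatrix finProdFinEquiv finProdFinEquiv := by
  ext i j
  simp [uMat, ev_X_false]

theorem usMat_map_ev (U : Matrix (Fin (b * N)) (Fin (b * N)) ℂ) :
    (usMat b N).map (ev U) = ((uMat b N).map (ev U))ᴴ := by
  ext i j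
  simp [uMat, usMat, ev_X_false, ev_X_true]

theorem uMat_map_ev_mem {U : Matrix (Fin (b * N)) (Fin (b * N)) ℂ}
    (hU : U ∈ Matrix.unitaryGroup (Fin (b * N)) ℂ) :
    (uMat b N).map (ev U) ∈ Matrix.unitaryGroup (Fin b × Fin N) ℂ := by
  rw [uMat_map_ev, Matrix.mem_unitaryGroup_iff, Matrix.star_eq_conjTranspose,
    Matrix.conjTranspose_submatrix, Matrix.submatrix_mul_equiv, ← Matrix.star_eq_conjTranspose,
    Matrix.mem_unitaryGroup_iff.1 hU, Matrix.submatrix_one_equiv]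

/-- Labels `(k, x, y, x', y')` of the contractions. -/
abbrev Label (b : ℕ) := ℕ × Fin b × Fin b × Fin b × Fin b

/-- The normalized contraction with a given label. -/
noncomputable def tau (N : ℕ) (t : Label b) : UPoly (b * N) :=
  (N : ℂ)⁻¹ • contr (pt (uMat b N)) (pt (usMat b N)) t.1 t.2.1 t.2.2.1 t.2.2.2.1 t.2.2.2.2

/-- A product of normalized contractions. -/
noncomputable def mon (N : ℕ) (L : List (Label b)) : UPoly (b * N) := (L.map (tau N)).prod

/-- Normalized partial trace of `(W* W)^k`. -/
noncomputable def dl (b N k : ℕ) (x y : Fin b) : UPoly (b * N) :=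
  (N : ℂ)⁻¹ • ptrace ((pt (usMat b N) * pt (uMat b N)) ^ k) x y

/-- Normalized partial trace of `(W W*)^k`. -/
noncomputable def dr (b N k : ℕ) (x y : Fin b) : UPoly (b * N) :=
  (N : ℂ)⁻¹ • ptrace ((pt (uMat b N) * pt (usMat b N)) ^ k) x y

theorem mon_cons (N : ℕ) (t : Label b) (L : List (Label b)) :
    mon N (t :: L) = tau N t * mon N L := by simp [mon]

theorem dl_zero (hN : N ≠ 0) (x y : Fin b) : dl b N 0 x y = if x = y then 1 else 0 := by
  rw [dl, pow_zero, ptrace_one]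
  split_ifs
  · rw [Fintype.card_fin, MvPolynomial.smul_eq_C_mul, ← map_natCast MvPolynomial.C,
      ← MvPolynomial.C_mul, inv_mul_cancel₀ (by exact_mod_cast hN), MvPolynomial.C_1]
  · simp

theorem dr_zero (hN : N ≠ 0) (x y : Fin b) : dr b N 0 x y = if x = y then 1 else 0 := by
  rw [dr, pow_zero, ← dl_zero hN, dl, pow_zero]

theorem dl_succ (k : ℕ) (x y : Fin b) :
    dl b N (k + 1) x y = ∑ z, tau N (k, z, y, x, z) := by
  rw [dl, ptrace_pow_succ, Finset.smul_sum]
  rfl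

theorem dr_succ (k : ℕ) (x y : Fin b) :
    dr b N (k + 1) x y = ∑ z, tau N (k, x, z, z, y) := by
  rw [dr, ptrace_pow_succ', Finset.smul_sum]
  rfl

theorem exists_bound_tau (t : Label b) : ∃ K : ℝ, 0 ≤ K ∧ ∀ N,
    ∀ U ∈ Matrix.unitaryGroup (Fin (b * N)) ℂ, ‖ev U (tau N t)‖ ≤ K := by
  refine ⟨(b : ℝ) ^ (2 * t.1 + 2) * b, by positivity, fun N U hU => ?_⟩
  have h := norm_map_contr_le (ev U) (uMat_map_ev_mem hU) (usMat_map_ev U) t.1 t.2.1 t.2.2.1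
    t.2.2.2.1 t.2.2.2.2
  rw [tau, map_smul, norm_smul, norm_inv, Complex.norm_natCast]
  simp only [Fintype.card_fin] at h
  rcases Nat.eq_zero_or_pos N with rfl | hN
  · simp; positivity
  · rw [inv_mul_le_iff₀ (by positivity)]
    exact h.trans (le_of_eq (by ring))

theorem exists_bound_mon (L : List (Label b)) : ∃ K : ℝ, 0 ≤ K ∧ ∀ N,
    ∀ U ∈ Matrix.unitaryGroup (Fin (b * N)) ℂ, ‖ev U (mon N L)‖ ≤ K := by
  induction L with
  | nil => exact ⟨1, zero_le_one, fun N U _ => by simp [mon]⟩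
  | cons t L ih =>
    obtain ⟨K, hK0, hK⟩ := ih
    obtain ⟨K', hK0', hK'⟩ := exists_bound_tau t
    refine ⟨K' * K, by positivity, fun N U hU => ?_⟩
    rw [mon_cons, map_mul, norm_mul]
    exact mul_le_mul (hK' N U hU) (hK N U hU) (norm_nonneg _) hK0'

/-- The error term of the loop equation. -/
noncomputable def defect (N : ℕ) (t : Label b) (q : UPoly (b * N)) : UPoly (b * N) :=
  ∑ β₁, ∑ β₂, alt (pt (uMat b N)) (pt (usMat b N)) t.1 (t.2.2.2.1, β₂) (t.2.2.2.2, β₁) *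
    blockD (t.2.1, β₂) (t.2.2.1, β₁) q

theorem defect_mul (N : ℕ) (t : Label b) (p q : UPoly (b * N)) :
    defect N t (p * q) = p * defect N t q + q * defect N t p := by
  simp only [defect, Finset.mul_sum, ← Finset.sum_add_distrib]
  refine Finset.sum_congr rfl fun _ _ => Finset.sum_congr rfl fun _ _ => ?_
  rw [Derivation.leibniz, smul_eq_mul, smul_eq_mul, mul_add, mul_left_comm, mul_left_comm _ q]

theorem exists_bound_defect_tau (t s : Label b) : ∃ K : ℝ, 0 ≤ K ∧ ∀ N,
    ∀ U ∈ Matrix.unitaryGroup (Fin (b * N)) ℂ, ‖ev U (defect N t (tau N s))‖ ≤ K * (N * √N) := by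
  refine ⟨(b : ℝ) ^ (2 * t.1 + 1) * ((2 * s.1 + 2) * (b : ℝ) ^ (2 * s.1 + 1) * √b),
    by positivity, fun N U hU => ?_⟩
  have h1 : ∀ β₁ β₂ : Fin N, ‖ev U (alt (pt (uMat b N)) (pt (usMat b N)) t.1 (t.2.2.2.1, β₂)
      (t.2.2.2.2, β₁) * blockD (t.2.1, β₂) (t.2.2.1, β₁) (tau N s))‖ ≤
      (N : ℝ)⁻¹ * ((b : ℝ) ^ (2 * t.1 + 1) * ((2 * s.1 + 2) * (b : ℝ) ^ (2 * s.1 + 1) * √(b * N))) := by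
    intro β₁ β₂
    have ha := norm_map_alt_le (ev U) (uMat_map_ev_mem hU) (usMat_map_ev U) t.1
      (t.2.2.2.1, β₂) (t.2.2.2.2, β₁)
    have hd := norm_deriv_contr_le (ev U) (uMat_map_ev_mem hU) (usMat_map_ev U) blockD
      isLoop_blockD t.2.1 t.2.2.1 β₁ β₂ s.1 s.2.1 s.2.2.1 s.2.2.2.1 s.2.2.2.2
    simp only [Fintype.card_fin] at ha hd
    rw [tau, Derivation.map_smul, map_mul, map_smul, norm_mul, norm_smul, norm_inv, Complex.norm_natCast,
      mul_left_comm]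
    gcongr
  simp only [defect, map_sum]
  refine (norm_sum_le _ _).trans ((Finset.sum_le_sum fun β₁ _ => (norm_sum_le _ _).trans
    (Finset.sum_le_sum fun β₂ _ => h1 β₁ β₂)).trans ?_)
  simp only [Finset.sum_const, Finset.card_univ, Fintype.card_fin, nsmul_eq_mul]
  rcases Nat.eq_zero_or_pos N with rfl | hN
  · simp
  · rw [Real.sqrt_mul (by positivity)]
    apply le_of_eq
    field_simp

theorem exists_bound_defect_mon (t : Label b) (L : List (Label b)) : ∃ K : ℝ, 0 ≤ K ∧ ∀ N,
    ∀ U ∈ Matrix.unitaryGroup (Fin (b * N)) ℂ, ‖ev U (defect N t (mon N L))‖ ≤ K * (N * √N) := by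
  induction L with
  | nil => exact ⟨0, le_rfl, fun N U _ => by simp [mon, defect]⟩
  | cons s L ih =>
    obtain ⟨K, hK0, hK⟩ := ih
    obtain ⟨K1, hK10, hK1⟩ := exists_bound_defect_tau t s
    obtain ⟨K2, hK20, hK2⟩ := exists_bound_tau s
    obtain ⟨K3, hK30, hK3⟩ := exists_bound_mon L
    refine ⟨K2 * K + K3 * K1, by positivity, fun N U hU => ?_⟩
    rw [mon_cons, defect_mul, map_add, map_mul, map_mul]
    refine (norm_add_le _ _).trans ?_
    rw [norm_mul, norm_mul, add_mul, mul_assoc, mul_assoc]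
    exact add_le_add (mul_le_mul (hK2 N U hU) (hK N U hU) (norm_nonneg _) hK20)
      (mul_le_mul (hK3 N U hU) (hK1 N U hU) (norm_nonneg _) hK30)

/-- `expect` as a linear map. -/
noncomputable def expectL {M : ℕ} {μ : Measure (Matrix (Fin M) (Fin M) ℂ)}
    (hμ : IsHaarUnitary M μ) : UPoly M →ₗ[ℂ] ℂ where
  toFun := expect μ
  map_add' := expect_add hμ
  map_smul' c p := by simp [expect_smul]

theorem expectL_apply {M : ℕ} {μ : Measure (Matrix (Fin M) (Fin M) ℂ)}
    (hμ : IsHaarUnitary M μ) (p : UPoly M) : expectL hμ p = expect μ p := rfl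

theorem expect_contr_mul {μ : Measure (Matrix (Fin (b * N)) (Fin (b * N)) ℂ)}
    (hμ : IsHaarUnitary (b * N) μ) (k : ℕ) (x y x' y' : Fin b) (q : UPoly (b * N)) :
    ((b * N : ℕ) : ℂ) * expectL hμ (contr (pt (uMat b N)) (pt (usMat b N)) k x y x' y' * q) =
      expectL hμ ((∑ β₁, ∑ β₂, blockD (x, β₂) (y, β₁)
        (alt (pt (uMat b N)) (pt (usMat b N)) k (x', β₂) (y', β₁))) * q) +
      expectL hμ (defect N (k, x, y, x', y') q) := by
  rw [← map_add]
  simp only [contr, defect, Finset.sum_mul, map_sum, Finset.mul_sum, ← Finset.sum_add_distrib]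
  refine Finset.sum_congr rfl fun β₁ _ => Finset.sum_congr rfl fun β₂ _ => ?_
  have hpt : pt (uMat b N) (x, β₁) (y, β₂) =
      MvPolynomial.X ((finProdFinEquiv (x, β₂), finProdFinEquiv (y, β₁)), false) := rfl
  generalize alt (pt (uMat b N)) (pt (usMat b N)) k (x', β₂) (y', β₁) = a
  have h := expect_loop hμ (finProdFinEquiv (x, β₂)) (finProdFinEquiv (y, β₁)) (a * q)
  rw [hpt, mul_assoc, expectL_apply, expectL_apply, h, Derivation.leibniz, smul_eq_mul,
    smul_eq_mul, add_comm, mul_comm q]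
  rfl

theorem loop_tau {μ : Measure (Matrix (Fin (b * N)) (Fin (b * N)) ℂ)}
    (hμ : IsHaarUnitary (b * N) μ) (hN : N ≠ 0) (k : ℕ) (x y x' y' : Fin b) (q : UPoly (b * N)) :
    (b : ℂ) * expectL hμ (tau N (k, x, y, x', y') * q) =
      ∑ j ∈ Finset.range (k + 1), expectL hμ (dl b N j x' y * (dr b N (k - j) x y' * q)) -
      ∑ j ∈ Finset.range k, ∑ z, ∑ z', expectL hμ (tau N (k - (j + 1), z, y, z', y') *
        (tau N (j, x, z', x', z) * q)) +
      ((N : ℂ) ^ 2)⁻¹ * expectL hμ (defect N (k, x, y, x', y') q) := by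
  have hN' : (N : ℂ) ≠ 0 := by exact_mod_cast hN
  have h := expect_contr_mul hμ k x y x' y' q
  rw [sum_loop_alt blockD isLoop_blockD, sub_mul, map_sub] at h
  simp only [Finset.sum_mul, map_sum] at h
  have e1 : ∀ j, expectL hμ (dl b N j x' y * (dr b N (k - j) x y' * q)) = ((N : ℂ) ^ 2)⁻¹ *
      expectL hμ (ptrace ((pt (usMat b N) * pt (uMat b N)) ^ j) x' y *
        ptrace ((pt (uMat b N) * pt (usMat b N)) ^ (k - j)) x y' * q) := by
    intro j
    simp only [dl, dr, smul_mul_assoc, mul_smul_comm, map_smul, smul_eq_mul, mul_assoc]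
    ring
  have e2 : ∀ j z z', expectL hμ (tau N (k - (j + 1), z, y, z', y') *
      (tau N (j, x, z', x', z) * q)) = ((N : ℂ) ^ 2)⁻¹ *
      expectL hμ (contr (pt (uMat b N)) (pt (usMat b N)) (k - (j + 1)) z y z' y' *
        contr (pt (uMat b N)) (pt (usMat b N)) j x z' x' z * q) := by
    intro j z z'
    simp only [tau, smul_mul_assoc, mul_smul_comm, map_smul, smul_eq_mul, mul_assoc]
    ring
  simp only [e1, e2, ← Finset.mul_sum]
  rw [← mul_sub, ← mul_add, ← h]
  simp only [tau, smul_mul_assoc, map_smul, smul_eq_mul]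
  push_cast
  field_simp

end HaarLoop

namespace HaarLoop

open NCPart

variable {b : ℕ}

/-- Limit of the normalized contraction with a given label. -/
noncomputable def val (t : Label b) : ℂ :=
  if t.2.1 = t.2.2.2.2 ∧ t.2.2.1 = t.2.2.2.1 then mom b (t.1 + 1) / b else 0

/-- Weight driving the induction on products of contractions. -/
def wt (L : List (Label b)) : ℕ := (L.map fun t => (t.1 + 1) ^ 2).sum

/-- Product of the limits over a list of labels. -/
noncomputable def valProd (L : List (Label b)) : ℂ := (L.map val).prod

theorem wt_cons (t : Label b) (L : List (Label b)) : wt (t :: L) = (t.1 + 1) ^ 2 + wt L := by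
  simp [wt]

theorem valProd_cons (t : Label b) (L : List (Label b)) : valProd (t :: L) = val t * valProd L := by
  simp [valProd]

variable {μ : (M : ℕ) → Measure (Matrix (Fin M) (Fin M) ℂ)}

theorem tendsto_dr_mul_mon (hb : 0 < b) (hμ : ∀ M, IsHaarUnitary M (μ M)) {n : ℕ}
    (H : ∀ L : List (Label b), wt L < n →
      Tendsto (fun N => expectL (hμ (b * N)) (mon N L)) atTop (nhds (valProd L)))
    (c : ℕ) (x y : Fin b) (L : List (Label b)) (hL : c ^ 2 + wt L < n) :
    Tendsto (fun N => expectL (hμ (b * N)) (dr b N c x y * mon N L)) atTop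
      (nhds ((if x = y then mom b c else 0) * valProd L)) := by
  have hb' : (b : ℂ) ≠ 0 := by exact_mod_cast hb.ne'
  cases c with
  | zero =>
    have hev : ∀ᶠ N in atTop, (if x = y then 1 else 0 : ℂ) * expectL (hμ (b * N)) (mon N L) =
        expectL (hμ (b * N)) (dr b N 0 x y * mon N L) := by
      filter_upwards [eventually_ne_atTop 0] with N hN
      rw [dr_zero hN]
      split_ifs <;> simp
    rw [mom_zero]
    exact ((H L (by simpa using hL)).const_mul _).congr' hev
  | succ c =>
    simp only [dr_succ, Finset.sum_mul, map_sum, ← mon_cons]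
    have hsum : (if x = y then mom b (c + 1) else 0) * valProd L =
        ∑ z, valProd ((c, x, z, z, y) :: L) := by
      simp only [valProd_cons, val, and_true, Finset.sum_const, Finset.card_univ,
        Fintype.card_fin, nsmul_eq_mul]
      split_ifs
      · field_simp
      · simp
    rw [hsum]
    exact tendsto_finsetSum _ fun z _ => H _ (by rw [wt_cons]; exact hL)

theorem tendsto_dl_mul_dr_mul_mon (hb : 0 < b) (hμ : ∀ M, IsHaarUnitary M (μ M)) {n : ℕ}
    (H : ∀ L : List (Label b), wt L < n →
      Tendsto (fun N => expectL (hμ (b * N)) (mon N L)) atTop (nhds (valProd L)))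
    (a c : ℕ) (x y z w : Fin b) (L : List (Label b)) (hL : a ^ 2 + c ^ 2 + wt L < n) :
    Tendsto (fun N => expectL (hμ (b * N)) (dl b N a z w * (dr b N c x y * mon N L))) atTop
      (nhds ((if z = w then mom b a else 0) * ((if x = y then mom b c else 0) * valProd L))) := by
  have hb' : (b : ℂ) ≠ 0 := by exact_mod_cast hb.ne'
  cases a with
  | zero =>
    have hev : ∀ᶠ N in atTop,
        (if z = w then 1 else 0 : ℂ) * expectL (hμ (b * N)) (dr b N c x y * mon N L) =
        expectL (hμ (b * N)) (dl b N 0 z w * (dr b N c x y * mon N L)) := by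
      filter_upwards [eventually_ne_atTop 0] with N hN
      rw [dl_zero hN]
      split_ifs <;> simp
    rw [mom_zero]
    exact ((tendsto_dr_mul_mon hb hμ H c x y L (by omega)).const_mul _).congr' hev
  | succ a =>
    simp only [dl_succ, Finset.sum_mul, map_sum]
    simp only [mul_left_comm (tau _ _) (dr _ _ _ _ _), ← mon_cons]
    have hsum : (if z = w then mom b (a + 1) else 0) *
        ((if x = y then mom b c else 0) * valProd L) =
        ∑ r, (if x = y then mom b c else 0) * valProd ((a, r, w, z, r) :: L) := by
      simp only [valProd_cons, val, true_and, Finset.sum_const, Finset.card_univ,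
        Fintype.card_fin, nsmul_eq_mul, eq_comm (a := w)]
      by_cases h : z = w
      · simp only [h, if_true]; field_simp
      · simp [h]
    rw [hsum]
    exact tendsto_finsetSum _ fun r _ =>
      tendsto_dr_mul_mon hb hμ H c x y _ (by rw [wt_cons]; simp only; omega)

theorem tendsto_defect (hμ : ∀ M, IsHaarUnitary M (μ M)) (t : Label b) (L : List (Label b)) :
    Tendsto (fun N : ℕ => ((N : ℂ) ^ 2)⁻¹ * expectL (hμ (b * N)) (defect N t (mon N L))) atTop
      (nhds 0) := by
  obtain ⟨K, hK0, hK⟩ := exists_bound_defect_mon t L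
  have hlim : Tendsto (fun N : ℕ => K * (√(N : ℝ))⁻¹) atTop (nhds 0) := by
    rw [← mul_zero K]
    exact (tendsto_inv_atTop_zero.comp
      (Real.tendsto_sqrt_atTop.comp tendsto_natCast_atTop_atTop)).const_mul K
  refine squeeze_zero_norm' ?_ hlim
  filter_upwards [eventually_gt_atTop 0] with N hN
  have h := norm_expect_le (hμ (b * N)) (defect N t (mon N L)) _ (hK N)
  rw [norm_mul, norm_inv, norm_pow, Complex.norm_natCast, expectL_apply]
  have hN' : (0 : ℝ) < N := by exact_mod_cast hN
  refine (mul_le_mul_of_nonneg_left h (by positivity)).trans (le_of_eq ?_)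
  have hs := Real.sq_sqrt hN'.le
  have hs0 : √(N : ℝ) ≠ 0 := (Real.sqrt_pos.2 hN').ne'
  field_simp
  rw [hs, mul_comm]

theorem tendsto_mon (hb : 0 < b) (hμ : ∀ M, IsHaarUnitary M (μ M)) (L : List (Label b)) :
    Tendsto (fun N => expectL (hμ (b * N)) (mon N L)) atTop (nhds (valProd L)) := by
  induction hn : wt L using Nat.strong_induction_on generalizing L with
  | _ n ih =>
    have H : ∀ L : List (Label b), wt L < n →
        Tendsto (fun N => expectL (hμ (b * N)) (mon N L)) atTop (nhds (valProd L)) :=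
      fun L hL => ih _ hL L rfl
    have hb' : (b : ℂ) ≠ 0 := by exact_mod_cast hb.ne'
    cases L with
    | nil =>
      have : ∀ N, expectL (hμ (b * N)) (mon N ([] : List (Label b))) = 1 := fun N => by
        rw [mon, List.map_nil, List.prod_nil, expectL_apply, expect_one (hμ _)]
      simp only [this]
      simp [valProd]
    | cons t L =>
      obtain ⟨k, x, y, x', y'⟩ := t
      rw [wt_cons] at hn
      simp only at hn
      have hlim := (((tendsto_finsetSum (Finset.range (k + 1)) fun j hj =>
        tendsto_dl_mul_dr_mul_mon hb hμ H j (k - j) x y' x' y L (by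
          have hj := Finset.mem_range.1 hj
          obtain ⟨i, rfl⟩ : ∃ i, k = j + i := ⟨k - j, by omega⟩
          rw [← hn, Nat.add_sub_cancel_left]
          nlinarith [Nat.zero_le (i * j)])).sub
        (tendsto_finsetSum (Finset.range k) fun j hj =>
          tendsto_finsetSum Finset.univ fun z _ => tendsto_finsetSum Finset.univ fun z' _ =>
            H ((k - (j + 1), z, y, z', y') :: (j, x, z', x', z) :: L) (by
              have hj := Finset.mem_range.1 hj
              obtain ⟨i, rfl⟩ : ∃ i, k = j + 1 + i := ⟨k - (j + 1), by omega⟩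
              rw [wt_cons, wt_cons, ← hn, Nat.add_sub_cancel_left]
              simp only
              nlinarith [Nat.zero_le (i * j)]))).add
        (tendsto_defect hμ (k, x, y, x', y') L)).const_mul ((b : ℂ)⁻¹)
      have hval : (b : ℂ)⁻¹ * (∑ j ∈ Finset.range (k + 1), (if x' = y then mom b j else 0) *
            ((if x = y' then mom b (k - j) else 0) * valProd L) -
          ∑ j ∈ Finset.range k, ∑ z, ∑ z',
            valProd ((k - (j + 1), z, y, z', y') :: (j, x, z', x', z) :: L) + 0) =
          valProd ((k, x, y, x', y') :: L) := by
        have e : ∀ j ∈ Finset.range k, ∑ z, ∑ z',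
            valProd ((k - (j + 1), z, y, z', y') :: (j, x, z', x', z) :: L) =
            (if x = y' ∧ y = x' then mom b (j + 1) * mom b (k - j) * ((b : ℂ) ^ 2)⁻¹ else 0) *
              valProd L := by
          intro j hj
          have hj := Finset.mem_range.1 hj
          rw [Finset.sum_eq_single y', Finset.sum_eq_single y]
          · simp only [valProd_cons, val, and_self, if_true]
            rw [show k - (j + 1) + 1 = k - j by omega]
            split_ifs
            · field_simp
            · simp
          · intro z' _ hz'
            simp [valProd_cons, val, hz'.symm]
          · simp
          · intro z _ hz
            simp [valProd_cons, val, hz]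
          · simp
        rw [Finset.sum_congr rfl e, valProd_cons, val]
        by_cases h1 : x = y'
        · by_cases h2 : y = x'
          · simp only [h1, h2, and_self, if_true]
            rw [mom_succ b hb k, ← Finset.sum_mul]
            simp only [← mul_assoc, ← Finset.sum_mul]
            field_simp
            ring
          · simp [h2, Ne.symm h2]
        · simp [h1]
      rw [hval] at hlim
      refine hlim.congr' ?_
      filter_upwards [eventually_ne_atTop 0] with N hN
      simp only [mon_cons]
      rw [← loop_tau (hμ (b * N)) hN, inv_mul_cancel_left₀ hb']

theorem pt_submatrix_eq (N : ℕ) (U : Matrix (Fin (b * N)) (Fin (b * N)) ℂ) :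
    (permMat (ptrans b N) U).submatrix finProdFinEquiv finProdFinEquiv =
      pt ((uMat b N).map (ev U)) := by
  rw [uMat_map_ev]
  ext i j
  simp only [permMat, ptrans, blockSwap, pt, Matrix.submatrix_apply, Matrix.of_apply,
    Equiv.trans_apply, Equiv.prodCongr_apply, Prod.map, Equiv.coe_fn_mk, Equiv.symm_apply_apply]

theorem trace_eq_ev (N n : ℕ) (U : Matrix (Fin (b * N)) (Fin (b * N)) ℂ) :
    Matrix.trace ((permMat (ptrans b N) U * (permMat (ptrans b N) U)ᴴ) ^ n) =
      ev U (∑ x, ptrace ((pt (uMat b N) * pt (usMat b N)) ^ n) x x) := by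
  have h : ((pt (uMat b N) * pt (usMat b N)) ^ n).map (ev U) =
      ((permMat (ptrans b N) U * (permMat (ptrans b N) U)ᴴ) ^ n).submatrix
        finProdFinEquiv finProdFinEquiv := by
    rw [← AlgHom.mapMatrix_apply, map_pow, map_mul]
    have h1 : (ev U).mapMatrix (pt (usMat b N)) = (pt ((uMat b N).map (ev U)))ᴴ := by
      rw [← pt_conjTranspose, ← usMat_map_ev]
      rfl
    have h2 : (ev U).mapMatrix (pt (uMat b N)) = pt ((uMat b N).map (ev U)) := rfl
    rw [h1, h2, ← pt_submatrix_eq, Matrix.conjTranspose_submatrix, Matrix.submatrix_mul_equiv]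
    exact (map_pow (Matrix.reindexAlgEquiv ℂ ℂ (finProdFinEquiv (m := b) (n := N)).symm)
      (permMat (ptrans b N) U * (permMat (ptrans b N) U)ᴴ) n).symm
  simp only [map_sum, ptrace]
  rw [← Fintype.sum_prod_type' (f := fun x β =>
    ev U (((pt (uMat b N) * pt (usMat b N)) ^ n) (x, β) (x, β))), Matrix.trace]
  refine (Fintype.sum_equiv finProdFinEquiv _ _ fun p => ?_).symm
  exact congrFun (congrFun h p) p

end HaarLoop

/-- For fixed `b`, the moments `E tr((U^Γ (U^Γ)^*)^n)` of the partially transposed Haar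
unitary converge to
`Σ_{π non-crossing, even blocks} Π_{B ∈ π} b^{2-|B|} (-1)^{|B|/2-1} C_{|B|/2-1}`. -/
theorem stmt16 (b : ℕ) (hb : 0 < b)
    (μ : (M : ℕ) → Measure (Matrix (Fin M) (Fin M) ℂ))
    (hμ : ∀ M, IsHaarUnitary M (μ M))
    (n : ℕ) (hn : 1 ≤ n) :
    Tendsto (fun N : ℕ => ∫ U, ((b * N : ℕ) : ℂ)⁻¹ *
        Matrix.trace ((permMat (ptrans b N) U * (permMat (ptrans b N) U)ᴴ) ^ n) ∂(μ (b * N)))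
      atTop (nhds (∑ᶠ (π : Finpartition (Finset.univ : Finset (Fin (2 * n))))
        (_ : NCEven n π), ∏ P ∈ π.parts,
          (b : ℂ) ^ ((2 : ℤ) - (P.card : ℤ)) * (-1) ^ (P.card / 2 - 1) *
            (catalan (P.card / 2 - 1) : ℂ))) := by
  rw [NCPart.finsum_eq_mom b n hn]
  have hb' : (b : ℂ) ≠ 0 := by exact_mod_cast hb.ne'
  have hlim := (tendsto_finsetSum (Finset.univ : Finset (Fin b)) fun x _ =>
    HaarLoop.tendsto_dr_mul_mon hb hμ (n := n ^ 2 + 1) (fun L _ => HaarLoop.tendsto_mon hb hμ L)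
      n x x [] (by simp [HaarLoop.wt])).const_mul ((b : ℂ)⁻¹)
  have hval : (b : ℂ)⁻¹ * ∑ x : Fin b, (if x = x then NCPart.mom b n else 0) *
      HaarLoop.valProd ([] : List (HaarLoop.Label b)) = NCPart.mom b n := by
    simp [HaarLoop.valProd, hb']
  rw [hval] at hlim
  refine hlim.congr fun N => ?_
  have h : ∀ U, ((b * N : ℕ) : ℂ)⁻¹ *
      Matrix.trace ((permMat (ptrans b N) U * (permMat (ptrans b N) U)ᴴ) ^ n) =
      HaarLoop.ev U ((b : ℂ)⁻¹ • ∑ x : Fin b, HaarLoop.dr b N n x x * HaarLoop.mon N []) := by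
    intro U
    rw [HaarLoop.trace_eq_ev]
    simp only [HaarLoop.dr, HaarLoop.mon, List.map_nil, List.prod_nil, mul_one,
      ← Finset.smul_sum, map_smul, smul_eq_mul]
    push_cast
    rw [mul_inv, mul_assoc]
  simp only [h]
  change _ = HaarLoop.expectL (hμ (b * N)) _
  rw [map_smul, map_sum, smul_eq_mul]
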